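/- arXiv:1409.5923 — 2 statements merged into one kernel-verified Lean document; each statement's English description precedes it below -/
import Mathlib

section
/- For all real numbers d_i > 1, c_i > 0, d_u > 1, c_u > 0 there exists p_* < 1 (depending only on d_i, c_i, d_u, c_u) such that: for every infinite, connected, locally finite graph G = (V,E) satisfying the local isoperimetric inequality L(d_i,c_i) and the volume upper bound V_u(d_u,c_u), and for every p with p_* < p ≤ 1, the Bernoulli product measure P_p on {0,1}^V gives probability one to the event that there exists exactly one infinite open cluster. -/
open MeasureTheory Filter

universe u

variable {V : Type u}

/-- The set of vertices within graph distance `r` of `x`. -/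
def gball (G : SimpleGraph V) (x : V) (r : ℝ) : Set V :=
  {y | ∃ p : G.Walk x y, (p.length : ℝ) ≤ r}

/-- The `r`-neighborhood `B(K, r)` of a set `K`. -/
def gnbhd (G : SimpleGraph V) (K : Set V) (r : ℝ) : Set V :=
  {y | ∃ x ∈ K, y ∈ gball G x r}

/-- The edge boundary of `A` relative to `B`, encoded as ordered pairs
`(a, b)` with `a ∈ A`, `b ∈ B \ A` and `a ~ b`. -/
def relBoundary (G : SimpleGraph V) (A B : Set V) : Set (V × V) :=
  {e | G.Adj e.1 e.2 ∧ e.1 ∈ A ∧ e.2 ∈ B ∧ e.2 ∉ A}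

/-- The edge boundary of `A`, encoded as ordered pairs `(a, b)` with
`a ∈ A`, `b ∉ A` and `a ~ b`. -/
def bdry (G : SimpleGraph V) (A : Set V) : Set (V × V) :=
  {e | G.Adj e.1 e.2 ∧ e.1 ∈ A ∧ e.2 ∉ A}

/-- The local isoperimetric inequality `L(dᵢ, cᵢ)`. -/
def LocalIso (G : SimpleGraph V) (di ci : ℝ) : Prop :=
  ∀ (x : V) (r : ℝ), 1 ≤ r → ∀ A : Set V, A ⊆ gball G x r →
    (A.ncard : ℝ) ≤ (gball G x r).ncard / 2 →
    ci * (A.ncard : ℝ) ^ ((di - 1) / di) ≤ ((relBoundary G A (gball G x r)).ncard : ℝ)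

/-- The volume upper bound `𝒱ᵤ(dᵤ, cᵤ)`. -/
def VolUpper (G : SimpleGraph V) (du cu : ℝ) : Prop :=
  ∀ (x : V) (r : ℝ), 1 ≤ r →
    (gball G x r).Finite ∧ ((gball G x r).ncard : ℝ) ≤ cu * r ^ du

/-- The volume lower bound `𝒱ₗ(dₗ, cₗ)`. -/
def VolLower (G : SimpleGraph V) (dl cl : ℝ) : Prop :=
  ∀ (x : V) (r : ℝ), 1 ≤ r → cl * r ^ dl ≤ ((gball G x r).ncard : ℝ)

/-- Every walk from `y` to `z` has length at least `t`; equivalently the graph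
distance from `y` to `z` (with value `∞` if unreachable) is at least `t`. -/
def distGE (G : SimpleGraph V) (y z : V) (t : ℝ) : Prop :=
  ∀ p : G.Walk y z, t ≤ (p.length : ℝ)

/-- The distance between the sets `A` and `B` is at least `t`. -/
def setDistGE (G : SimpleGraph V) (A B : Set V) (t : ℝ) : Prop :=
  ∀ a ∈ A, ∀ b ∈ B, distGE G a b t

/-- The diameter of `A` is at least `t`. -/
def diamGE (G : SimpleGraph V) (A : Set V) (t : ℝ) : Prop :=
  ∃ y ∈ A, ∃ z ∈ A, distGE G y z t

/-- The diameter of `A` is at most `t`. -/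
def diamLE (G : SimpleGraph V) (A : Set V) (t : ℝ) : Prop :=
  ∀ y ∈ A, ∀ z ∈ A, ∃ p : G.Walk y z, (p.length : ℝ) ≤ t

/-- `A` is a connected set of vertices. -/
def ConnSet (G : SimpleGraph V) (A : Set V) : Prop := (G.induce A).Connected

/-- There is an open path, all of whose vertices lie in `S`, connecting `A` to `A'`:
its first vertex lies in `B(A,1)` and its last vertex in `B(A',1)`. -/
def ConnectsIn (G : SimpleGraph V) (ω : V → Bool) (A A' S : Set V) : Prop :=
  ∃ (a b : V) (p : G.Walk a b), a ∈ gnbhd G A 1 ∧ b ∈ gnbhd G A' 1 ∧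
    (∀ v ∈ p.support, v ∈ S) ∧ (∀ v ∈ p.support, ω v = true)

/-- The separation event `𝒮(x, L)`. -/
def sep (G : SimpleGraph V) (ω : V → Bool) (x : V) (L : ℝ) : Prop :=
  ∃ A B : Set V, A ⊆ gball G x (3 * L / 6) ∧ B ⊆ gball G x (3 * L / 6) ∧
    ConnSet G A ∧ ConnSet G B ∧ setDistGE G A B 2 ∧
    diamGE G A (L / 100) ∧ diamGE G B (L / 100) ∧
    ¬ ConnectsIn G ω A B (gball G x L)

/-- The open cluster `𝒞ₓ` of `x` (empty when `x` is closed). -/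
def openCluster (G : SimpleGraph V) (ω : V → Bool) (x : V) : Set V :=
  {y | ω x = true ∧ ∃ p : G.Walk x y, ∀ v ∈ p.support, ω v = true}

/-- There is exactly one infinite open cluster. -/
def UniqueInfCluster (G : SimpleGraph V) (ω : V → Bool) : Prop :=
  (∃ x, (openCluster G ω x).Infinite) ∧
    ∀ x y, (openCluster G ω x).Infinite → (openCluster G ω y).Infinite →
      openCluster G ω x = openCluster G ω y

/-- `P` is the Bernoulli product measure on `{0,1}^V` with parameter `p`, characterized by
its values on cylinder events. -/
def IsBernoulli (P : Measure (V → Bool)) (p : ℝ) : Prop :=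
  ∀ (F : Finset V) (η : V → Bool),
    P {ω | ∀ x ∈ F, ω x = η x} =
      ENNReal.ofReal (p ^ (F.filter fun x => η x = true).card *
        (1 - p) ^ (F.filter fun x => η x = false).card)

/-- A decreasing event. -/
def DecreasingEvent (E : Set (V → Bool)) : Prop :=
  ∀ ω ∈ E, ∀ ω' : V → Bool, (∀ x, ω' x ≤ ω x) → ω' ∈ E

/-- The σ-algebra `σ(Y_z ; z ∈ S)` generated by the coordinates in `S`. -/
def cylσ (S : Set V) : MeasurableSpace (V → Bool) :=
  MeasurableSpace.comap (fun ω => S.restrict ω) MeasurableSpace.pi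

/-- The decoupling inequality `𝒟(α, c_α)`. -/
def Decoupling (G : SimpleGraph V) (P : Measure (V → Bool)) (α cα : ℝ) : Prop :=
  ∀ (x : V) (r : ℝ), 1 ≤ r → ∀ E E' : Set (V → Bool),
    DecreasingEvent E → DecreasingEvent E' →
    MeasurableSet[cylσ (gball G x r)] E →
    MeasurableSet[cylσ (gball G x (2 * r))ᶜ] E' →
    P (E ∩ E') ≤ P E * P E' + ENNReal.ofReal (cα * r ^ (-α))

/-- The scales `L₀ = 10000`, `L_{k+1} = L_k ^ γ`. -/
noncomputable def Lseq (γ : ℝ) : ℕ → ℝ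
  | 0 => 10000
  | k + 1 => Lseq γ k ^ γ

namespace PercAux

/-- Walk-connected sets. -/
def PC (G : SimpleGraph V) (A : Set V) : Prop :=
  ∀ a ∈ A, ∀ b ∈ A, ∃ p : G.Walk a b, ∀ v ∈ p.support, v ∈ A

/-- Good vertices at scale `n`. -/
def Good (G : SimpleGraph V) (ω : V → Bool) (z : V) (n : ℕ) : Prop :=
  ∀ A B : Set V, PC G A → PC G B → (n : ℕ∞) ≤ A.encard → (n : ℕ∞) ≤ B.encard →
    (∃ a ∈ A, G.dist z a ≤ 2 * n) → (∃ b ∈ B, G.dist z b ≤ 2 * n) →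
    ∃ a ∈ A, ∃ b ∈ B, ∃ p : G.Walk a b,
      ∀ v ∈ p.support, v ∈ A ∨ v ∈ B ∨ (ω v = true ∧ G.dist z v ≤ 4 * n)

/-- Vertices reachable from `K` through `O`. -/
inductive Reach (G : SimpleGraph V) (K O : Set V) : V → Prop
  | base (v : V) : v ∈ K → Reach G K O v
  | step (v u : V) : Reach G K O v → G.Adj v u → u ∈ O → Reach G K O u

def RS (G : SimpleGraph V) (K O : Set V) : Set V := {v | Reach G K O v}

lemma Reach.walk {G : SimpleGraph V} {K O : Set V} {v : V} (h : Reach G K O v) :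
    ∃ a ∈ K, ∃ p : G.Walk a v, (∀ w ∈ p.support, w ∈ K ∨ w ∈ O) ∧
      ∀ w ∈ p.support, w ∈ RS G K O := by
  induction h with
  | base v hv =>
    exact ⟨v, hv, SimpleGraph.Walk.nil, by simp [hv], by
      intro w hw
      rw [SimpleGraph.Walk.mem_support_nil_iff] at hw
      subst hw
      exact Reach.base _ hv⟩
  | step v u hv hadj hu ih =>
    obtain ⟨a, ha, p, hp, hp'⟩ := ih
    refine ⟨a, ha, p.concat hadj, ?_, ?_⟩
    · intro w hw
      simp only [SimpleGraph.Walk.support_concat, List.mem_append,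
        List.mem_singleton] at hw
      rcases hw with hw | rfl
      · exact hp w hw
      · exact Or.inr hu
    · intro w hw
      simp only [SimpleGraph.Walk.support_concat, List.mem_append,
        List.mem_singleton] at hw
      rcases hw with hw | rfl
      · exact hp' w hw
      · exact Reach.step v _ hv hadj hu

lemma RS_PC {G : SimpleGraph V} {K O : Set V} (hK : PC G K) : PC G (RS G K O) := by
  intro a ha b hb
  obtain ⟨a', ha', p, -, hp⟩ := Reach.walk ha
  obtain ⟨b', hb', q, -, hq⟩ := Reach.walk hb
  obtain ⟨r, hr⟩ := hK a' ha' b' hb'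
  refine ⟨p.reverse.append (r.append q), ?_⟩
  intro v hv
  simp only [SimpleGraph.Walk.mem_support_append_iff, SimpleGraph.Walk.support_reverse,
    List.mem_reverse] at hv
  rcases hv with hv | hv | hv
  · exact hp v hv
  · exact Reach.base v (hr v hv)
  · exact hq v hv

lemma touch {G : SimpleGraph V} {C B O : Set V}
    (hC : ∀ v ∈ C, ∀ u, G.Adj v u → u ∈ O → u ∈ C) {a b : V} (p : G.Walk a b)
    (ha : a ∈ C) (hb : b ∈ B) (hp : ∀ v ∈ p.support, v ∈ C ∨ v ∈ B ∨ v ∈ O) :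
    ∃ c ∈ C, ∃ b ∈ B, c = b ∨ G.Adj c b := by
  induction p with
  | nil => exact ⟨_, ha, _, hb, Or.inl rfl⟩
  | @cons u v w h p ih =>
    have hp' : ∀ x ∈ p.support, x ∈ C ∨ x ∈ B ∨ x ∈ O := fun x hx => hp x (by simp [hx])
    rcases hp' v p.start_mem_support with hv | hv | hv
    · exact ih hv hb hp'
    · exact ⟨u, ha, v, hv, Or.inr h⟩
    · exact ih (hC u ha v h hv) hb hp'

/-- Discrete intermediate value. -/
lemma ivt {G : SimpleGraph V} (hG : G.Connected) (x : V) (t : ℕ) {a b : V} (p : G.Walk a b)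
    (ha : G.dist x a ≤ t) (hb : t ≤ G.dist x b) : ∃ v ∈ p.support, G.dist x v = t := by
  induction p with
  | nil => exact ⟨_, by simp, le_antisymm ha hb⟩
  | @cons u v w h p ih =>
    by_cases hv : G.dist x v ≤ t
    · obtain ⟨y, hy, hy'⟩ := ih hv hb
      exact ⟨y, by simp [hy], hy'⟩
    · have h1 := hG.dist_triangle (u := x) (v := u) (w := v)
      have h2 : G.dist u v = 1 := SimpleGraph.dist_eq_one_iff_adj.mpr h
      exact ⟨u, by simp, by omega⟩

/-- Balls. -/
def NB (G : SimpleGraph V) (x : V) (n : ℕ) : Set V := {y | G.dist x y ≤ n}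

lemma gball_eq {G : SimpleGraph V} (hG : G.Connected) (x : V) (n : ℕ) :
    gball G x (n : ℝ) = NB G x n := by
  ext y
  simp only [gball, NB, Set.mem_ofPred_eq, Nat.cast_le]
  constructor
  · rintro ⟨p, hp⟩
    exact (SimpleGraph.dist_le p).trans hp
  · intro h
    obtain ⟨p, hp⟩ := hG.exists_walk_length_eq_dist x y
    exact ⟨p, hp ▸ h⟩

lemma walk_dist {G : SimpleGraph V} {x y : V} (p : G.Walk x y) :
    ∀ v ∈ p.support, G.dist x v ≤ p.length := by
  classical
  intro v hv
  exact (SimpleGraph.dist_le (p.takeUntil v hv)).trans (p.length_takeUntil_le_length hv)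

lemma NB_walk {G : SimpleGraph V} (hG : G.Connected) (x : V) (n : ℕ) {y : V} (hy : y ∈ NB G x n) :
    ∃ p : G.Walk x y, ∀ v ∈ p.support, v ∈ NB G x n := by
  obtain ⟨p, hp⟩ := hG.exists_walk_length_eq_dist x y
  exact ⟨p, fun v hv => (walk_dist p v hv).trans (hp ▸ hy)⟩

lemma NB_PC {G : SimpleGraph V} (hG : G.Connected) (x : V) (n : ℕ) : PC G (NB G x n) := by
  intro a ha b hb
  obtain ⟨p, hp⟩ := NB_walk hG x n ha
  obtain ⟨q, hq⟩ := NB_walk hG x n hb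
  refine ⟨p.reverse.append q, ?_⟩
  intro v hv
  simp only [SimpleGraph.Walk.mem_support_append_iff, SimpleGraph.Walk.support_reverse,
    List.mem_reverse] at hv
  rcases hv with hv | hv
  · exact hp v hv
  · exact hq v hv

lemma size_far {G : SimpleGraph V} (hG : G.Connected) (x : V) (r n : ℕ)
    {A : Set V} (hA : PC G A) {a b : V} (ha : a ∈ A) (har : G.dist x a ≤ r)
    (hb : b ∈ A) (hbr : r + n ≤ G.dist x b) :
    (n : ℕ∞) ≤ (A ∩ NB G x (r + n)).encard := by
  obtain ⟨p, hp⟩ := hA a ha b hb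
  have h1 : Set.Ioc r (r + n) ⊆ (fun v => G.dist x v) '' (A ∩ NB G x (r + n)) := by
    intro t ht
    obtain ⟨v, hv, hvt⟩ := ivt hG x t p (har.trans ht.1.le) (ht.2.trans hbr)
    exact ⟨v, ⟨hp v hv, by rw [NB, Set.mem_ofPred_eq, hvt]; exact ht.2⟩, hvt⟩
  have h2 : (Set.Ioc r (r + n)).encard = n := by
    rw [← Finset.coe_Ioc, Set.encard_coe_eq_coe_finsetCard]; simp
  calc (n : ℕ∞) = (Set.Ioc r (r + n)).encard := h2.symm
    _ ≤ _ := Set.encard_le_encard h1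
    _ ≤ _ := Set.encard_image_le _ _

lemma size_in {G : SimpleGraph V} (hG : G.Connected) (x : V) (n : ℕ)
    {A : Set V} (hA : PC G A) (hn : (n : ℕ∞) ≤ A.encard) (ha : ∃ a ∈ A, G.dist x a ≤ 2 * n) :
    (n : ℕ∞) ≤ (A ∩ NB G x (3 * n)).encard := by
  obtain ⟨a, ha, har⟩ := ha
  by_cases h : A ⊆ NB G x (3 * n)
  · rwa [Set.inter_eq_left.mpr h]
  · obtain ⟨b, hb, hb'⟩ := Set.not_subset.mp h
    have : ¬ G.dist x b ≤ 3 * n := hb'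
    have := size_far hG x (2 * n) n hA ha har hb (by omega)
    rwa [show 2 * n + n = 3 * n by ring] at this

lemma exists_far {G : SimpleGraph V} [Infinite V]
    (hfin : ∀ x n, (NB G x n).Finite) (x : V) (n : ℕ) : ∃ b, n < G.dist x b := by
  by_contra h
  push Not at h
  have : NB G x n = Set.univ := Set.eq_univ_of_forall h
  exact Set.infinite_univ (this ▸ hfin x n)

lemma NB_size {G : SimpleGraph V} (hG : G.Connected) [Infinite V]
    (hfin : ∀ x n, (NB G x n).Finite) (x : V) (n : ℕ) : (n : ℕ∞) ≤ (NB G x n).encard := by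
  obtain ⟨b, hb⟩ := exists_far hfin x n
  have hu : PC G Set.univ := fun a _ b _ => by
    obtain ⟨p⟩ := hG.preconnected a b
    exact ⟨p, by simp⟩
  have := size_far hG x 0 n hu (Set.mem_univ x) (by simp) (Set.mem_univ b) (by omega)
  simpa using this

/-- One step of the chaining. -/
lemma chain_touch {G : SimpleGraph V} {ω : V → Bool} {z : V} {n : ℕ}
    (hgood : Good G ω z n) {C B O : Set V} (hCp : PC G C) (hBp : PC G B)
    (hC : ∀ v ∈ C, ∀ u, G.Adj v u → u ∈ O → u ∈ C) (hCn : (n : ℕ∞) ≤ C.encard)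
    (hBn : (n : ℕ∞) ≤ B.encard) (hCz : ∃ a ∈ C, G.dist z a ≤ 2 * n)
    (hBz : ∃ a ∈ B, G.dist z a ≤ 2 * n)
    (hO : ∀ v, ω v = true → G.dist z v ≤ 4 * n → v ∈ O) :
    ∃ c ∈ C, ∃ b ∈ B, c = b ∨ G.Adj c b := by
  obtain ⟨a, ha, b, hb, p, hp⟩ := hgood C B hCp hBp hCn hBn hCz hBz
  exact touch hC p ha hb fun v hv => by
    rcases hp v hv with h | h | h
    · exact Or.inl h
    · exact Or.inr (Or.inl h)
    · exact Or.inr (Or.inr (hO v h.1 h.2))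

lemma chain_step {G : SimpleGraph V} (hG : G.Connected) [Infinite V]
    (hfin : ∀ x n, (NB G x n).Finite) {ω : V → Bool} {z z' : V} {n : ℕ} (hn2 : 2 ≤ n)
    (hgood : Good G ω z n) {C O : Set V} (hCp : PC G C)
    (hC : ∀ v ∈ C, ∀ u, G.Adj v u → u ∈ O → u ∈ C) (hCn : (n : ℕ∞) ≤ C.encard)
    (hCz : ∃ a ∈ C, G.dist z a ≤ 2 * n)
    (hO : ∀ v, ω v = true → G.dist z v ≤ 4 * n → v ∈ O) (hadj : G.Adj z z') :
    ∃ a ∈ C, G.dist z' a ≤ 2 * n := by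
  obtain ⟨c, hc, b, hb, h⟩ := chain_touch hgood hCp (NB_PC hG z n) hC hCn (NB_size hG hfin z n) hCz
    ⟨z, by simp [NB], by simp⟩ hO
  refine ⟨c, hc, ?_⟩
  have h1 : G.dist z' z = 1 := SimpleGraph.dist_eq_one_iff_adj.mpr hadj.symm
  have h2 : G.dist z b ≤ n := hb
  have h3 := hG.dist_triangle (u := z') (v := z) (w := c)
  have h4 := hG.dist_triangle (u := z) (v := b) (w := c)
  have h5 : G.dist b c ≤ 1 := by
    rcases h with rfl | h
    · simp
    · exact (SimpleGraph.dist_eq_one_iff_adj.mpr h.symm).le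
  omega

/-- The cut lemma: a small set `Z` cannot separate large sets. -/
lemma cut {G : SimpleGraph V} {S Z A B : Set V} (hS : S.Finite)
    (D z m : ℕ) (hZ : Z.Finite) (hzm : Z.ncard ≤ z)
    (hdeg : ∀ x, ({y | G.Adj x y} : Set V).Finite ∧ ({y | G.Adj x y} : Set V).ncard ≤ D)
    (hiso : ∀ U ⊆ S, 2 * U.ncard ≤ S.ncard → m ≤ 2 * U.ncard →
      D * z < (relBoundary G U S).ncard)
    (hm : 2 * z ≤ m) (hA : m ≤ (A ∩ S).ncard) (hB : m ≤ (B ∩ S).ncard) :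
    ∃ v, v ∈ B ∧ Reach G ((A ∩ S) \ Z) (S \ Z) v := by
  classical
  by_contra hcon
  push Not at hcon
  set U : Set V := RS G ((A ∩ S) \ Z) (S \ Z) with hU
  have hUS : U ⊆ S \ Z := by
    intro v hv
    have hv : Reach G ((A ∩ S) \ Z) (S \ Z) v := hv
    cases hv with
    | base _ h => exact ⟨h.1.2, h.2⟩
    | step _ _ _ _ h => exact h
  have hUc : ∀ u ∈ U, ∀ v ∈ S, G.Adj u v → v ∉ U → v ∈ Z := by
    intro u hu v hv hadj hvU
    by_contra hvZ
    exact hvU (Reach.step u v hu hadj ⟨hv, hvZ⟩)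
  have hAU : (A ∩ S) ⊆ U ∪ Z := by
    intro v hv
    by_cases hvZ : v ∈ Z
    · exact Or.inr hvZ
    · exact Or.inl (Reach.base v ⟨hv, hvZ⟩)
  have hUfin : U.Finite := hS.subset (hUS.trans Set.sdiff_subset)
  have h1 : m ≤ U.ncard + z := by
    calc m ≤ _ := hA
      _ ≤ _ := Set.ncard_le_ncard hAU (hUfin.union hZ)
      _ ≤ _ := Set.ncard_union_le _ _
      _ ≤ _ := by omega
  have h2 : m ≤ (S \ U).ncard := by
    refine hB.trans (Set.ncard_le_ncard ?_ (hS.subset Set.sdiff_subset))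
    intro v hv
    exact ⟨hv.2, hcon v hv.1⟩
  have h3 : (S \ U).ncard + U.ncard = S.ncard :=
    Set.ncard_sdiff_add_ncard_of_subset (hUS.trans Set.sdiff_subset) hS
  -- counting boundary pairs
  have hbig : ∀ (f : V → V → V × V) (E : Set (V × V)),
      (∀ e ∈ E, ∃ x ∈ Z, ∃ y, G.Adj x y ∧ e = f x y) → E.ncard ≤ D * z := by
    intro f E hE
    let W : Finset (V × V) := hZ.toFinset.biUnion
      fun x => ((hdeg x).1.toFinset).image (f x)
    have hEW : E ⊆ (W : Set (V × V)) := by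
      intro e he
      obtain ⟨x, hx, y, hxy, rfl⟩ := hE e he
      simp only [W, Finset.coe_biUnion, Set.mem_iUnion, Finset.mem_coe, Finset.mem_image,
        Set.Finite.mem_toFinset, Set.mem_ofPred_eq]
      exact ⟨x, hx, y, hxy, rfl⟩
    calc E.ncard ≤ (W : Set (V × V)).ncard := Set.ncard_le_ncard hEW (Finset.finite_toSet _)
      _ = W.card := Set.ncard_coe_finset _
      _ ≤ hZ.toFinset.card * D := by
          apply Finset.card_biUnion_le_card_mul
          intro x _
          refine Finset.card_image_le.trans ?_
          rw [← Set.ncard_eq_toFinset_card _ (hdeg x).1]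
          exact (hdeg x).2
      _ ≤ z * D := by
          rw [← Set.ncard_eq_toFinset_card _ hZ]
          exact Nat.mul_le_mul_right _ hzm
      _ = D * z := Nat.mul_comm _ _
  rcases le_total (2 * U.ncard) S.ncard with h | h
  · have := hiso U (hUS.trans Set.sdiff_subset) h (by omega)
    have := hbig (fun x y => (y, x)) (relBoundary G U S) (by
      rintro ⟨u, v⟩ ⟨hadj, hu, hv, hvU⟩
      exact ⟨v, hUc u hu v hv hadj hvU, u, hadj.symm, rfl⟩)
    omega
  · have := hiso (S \ U) Set.sdiff_subset (by omega) (by omega)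
    have := hbig (fun x y => (x, y)) (relBoundary G (S \ U) S) (by
      rintro ⟨u, v⟩ ⟨hadj, hu, hv, hvU⟩
      have hvU' : v ∈ U := by
        by_contra h'
        exact hvU ⟨hv, h'⟩
      exact ⟨u, hUc v hvU' u hu.1 hadj.symm hu.2, v, hadj, rfl⟩)
    omega

lemma renorm {G : SimpleGraph V} (hG : G.Connected) [Infinite V]
    (hfin : ∀ x n, (NB G x n).Finite) {ω : V → Bool} {x : V} {n n' : ℕ} (hn2 : 2 ≤ n)
    (hnn : 4 * n ≤ n') {Z : Set V}
    (D z : ℕ) (hZ : Z.Finite) (hzm : Z.ncard ≤ z)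
    (hdeg : ∀ x, ({y | G.Adj x y} : Set V).Finite ∧ ({y | G.Adj x y} : Set V).ncard ≤ D)
    (hiso : ∀ U ⊆ NB G x (3 * n'), 2 * U.ncard ≤ (NB G x (3 * n')).ncard → n' ≤ 2 * U.ncard →
      D * z < (relBoundary G U (NB G x (3 * n'))).ncard)
    (hm : 2 * z ≤ n')
    (hgood : ∀ y ∈ NB G x (3 * n'), y ∉ Z → Good G ω y n) : Good G ω x n' := by
  intro A B hA hB hAn hBn hAx hBx
  have hcast : ∀ T : Set V, (n' : ℕ∞) ≤ (T ∩ NB G x (3 * n')).encard →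
      n' ≤ (T ∩ NB G x (3 * n')).ncard := by
    intro T hT
    rw [← Set.Finite.cast_ncard_eq ((hfin x (3 * n')).subset Set.inter_subset_right)] at hT
    exact_mod_cast hT
  obtain ⟨v, hvB, hv⟩ := cut (hfin x (3 * n')) D z n' hZ hzm hdeg hiso hm
    (hcast A (size_in hG x n' hA hAn hAx)) (hcast B (size_in hG x n' hB hBn hBx))
  set O : Set V := {v | ω v = true ∧ G.dist x v ≤ 4 * n'} with hO
  set C : Set V := RS G A O with hC
  have hCp : PC G C := RS_PC hA
  have hAC : A ⊆ C := fun a ha => Reach.base a ha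
  have hCc : ∀ v ∈ C, ∀ u, G.Adj v u → u ∈ O → u ∈ C := fun v hv u h1 h2 => Reach.step v u hv h1 h2
  have hcn : (n : ℕ∞) ≤ (n' : ℕ∞) := by exact_mod_cast (by omega : n ≤ n')
  have hCn : (n : ℕ∞) ≤ C.encard := hcn.trans (hAn.trans (Set.encard_le_encard hAC))
  have hOz : ∀ y ∈ NB G x (3 * n'), ∀ v, ω v = true → G.dist y v ≤ 4 * n → v ∈ O := by
    intro y hy v hv hd
    refine ⟨hv, ?_⟩
    have h3 := hG.dist_triangle (u := x) (v := y) (w := v)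
    have : G.dist x y ≤ 3 * n' := hy
    omega
  have key : ∀ y, Reach G ((A ∩ NB G x (3 * n')) \ Z) (NB G x (3 * n') \ Z) y →
      (y ∈ NB G x (3 * n') ∧ y ∉ Z) ∧ ∃ a ∈ C, G.dist y a ≤ 2 * n := by
    intro y hy
    induction hy with
    | base y h => exact ⟨⟨h.1.2, h.2⟩, y, hAC h.1.1, by simp⟩
    | step y y' hy hadj hy' ih =>
      refine ⟨hy', ?_⟩
      exact chain_step hG hfin hn2 (hgood y ih.1.1 ih.1.2) hCp hCc hCn ih.2 (hOz y ih.1.1) hadj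
  obtain ⟨⟨hvS, hvZ⟩, hvC⟩ := key v hv
  obtain ⟨c, hc, b, hb, hcb⟩ := chain_touch (hgood v hvS hvZ) hCp hB hCc hCn (hcn.trans hBn) hvC
    ⟨v, hvB, by simp⟩ (hOz v hvS)
  obtain ⟨a, ha, p, hp, -⟩ := Reach.walk hc
  rcases hcb with rfl | hadj
  · exact ⟨a, ha, c, hb, p, fun v hv => by
      rcases hp v hv with h | h
      · exact Or.inl h
      · exact Or.inr (Or.inr h)⟩
  · refine ⟨a, ha, b, hb, p.concat hadj, ?_⟩
    intro w hw
    simp only [SimpleGraph.Walk.support_concat, List.mem_append, List.mem_singleton] at hw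
    rcases hw with hw | rfl
    · rcases hp w hw with h | h
      · exact Or.inl h
      · exact Or.inr (Or.inr h)
    · exact Or.inr (Or.inl hb)

lemma good_base {G : SimpleGraph V} (hG : G.Connected) {ω : V → Bool} {x : V} {n : ℕ}
    (h : ∀ v, G.dist x v ≤ 4 * n → ω v = true) : Good G ω x n := by
  intro A B _ _ _ _ ⟨a, ha, hax⟩ ⟨b, hb, hbx⟩
  obtain ⟨p, hp⟩ := NB_PC hG x (2 * n) a hax b hbx
  refine ⟨a, ha, b, hb, p, fun v hv => Or.inr (Or.inr ?_)⟩
  have : G.dist x v ≤ 2 * n := hp v hv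
  exact ⟨h v (by omega), by omega⟩

open Classical in
lemma greedy (G : SimpleGraph V) (r : ℕ) (Bad : Set V) (m : ℕ) :
    (∃ S : Finset V, (∀ s ∈ S, s ∈ Bad) ∧ S.card = m ∧
      ∀ s ∈ S, ∀ t ∈ S, s ≠ t → r < G.dist s t) ∨
    (∃ S : Finset V, S.card ≤ m ∧ ∀ b ∈ Bad, ∃ s ∈ S, G.dist s b ≤ r) := by
  induction m with
  | zero => exact Or.inl ⟨∅, by simp⟩
  | succ m ih =>
    rcases ih with ⟨S, h1, h2, h3⟩ | ⟨S, h1, h2⟩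
    · by_cases h : ∀ b ∈ Bad, ∃ s ∈ S, G.dist s b ≤ r
      · exact Or.inr ⟨S, by omega, h⟩
      · push Not at h
        obtain ⟨b, hb, hbS⟩ := h
        have hbn : b ∉ S := fun hbs => by
          have := hbS b hbs
          simp at this
        refine Or.inl ⟨insert b S, ?_, ?_, ?_⟩
        · intro s hs
          rcases Finset.mem_insert.mp hs with rfl | hs
          · exact hb
          · exact h1 s hs
        · rw [Finset.card_insert_of_notMem hbn, h2]
        · intro s hs t ht hst
          rcases Finset.mem_insert.mp hs with hs' | hs' <;>
            rcases Finset.mem_insert.mp ht with ht' | ht'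
          · exact absurd (hs'.trans ht'.symm) hst
          · rw [SimpleGraph.dist_comm, hs']; exact hbS t ht'
          · rw [ht']; exact hbS s hs'
          · exact h3 s hs' t ht' hst
    · exact Or.inr ⟨S, by omega, h2⟩

open Classical in
/-- Witness families. -/
noncomputable def TT (bl : V → ℕ → Finset V) (n0 g M : ℕ) : ℕ → V → Finset (Finset V)
  | 0, x => (bl x (4 * n0)).image (fun y => {y})
  | k + 1, x => ((Fintype.piFinset fun _ : Fin M =>
      (bl x (3 * n0 ^ (g ^ (k + 1)))).biUnion (TT bl n0 g M k)).image
        (fun f => Finset.univ.biUnion f)).filter (fun F => F.card = M ^ (k + 1))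

lemma TT_card {bl : V → ℕ → Finset V} {n0 g M k : ℕ} {x : V} {F : Finset V}
    (hF : F ∈ TT bl n0 g M k x) : F.card = M ^ k := by
  classical
  cases k with
  | zero =>
    simp only [TT, Finset.mem_image] at hF
    obtain ⟨y, _, rfl⟩ := hF
    simp
  | succ k =>
    simp only [TT, Finset.mem_filter] at hF
    exact hF.2

lemma TT_count {bl : V → ℕ → Finset V} {n0 g e : ℕ} (hg : 1 ≤ g)
    (hbl : ∀ x k, (bl x (4 * n0 ^ (g ^ k))).card ≤ (n0 ^ (g ^ k)) ^ e)
    (hbl3 : ∀ x k, (bl x (3 * n0 ^ (g ^ k))).card ≤ (n0 ^ (g ^ k)) ^ e) (k : ℕ) :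
    ∃ b : ℕ, b + 2 * e * g * g ^ k = (e + 2 * e * g) * (2 * g) ^ k ∧
      ∀ x, (TT bl n0 g (2 * g) k x).card ≤ n0 ^ b := by
  classical
  induction k with
  | zero =>
    refine ⟨e, by ring, fun x => ?_⟩
    have := hbl x 0
    simp only [pow_zero, pow_one] at this
    exact Finset.card_image_le.trans this
  | succ k ih =>
    obtain ⟨b, hb, hc⟩ := ih
    refine ⟨(e * g ^ (k + 1) + b) * (2 * g), ?_, fun x => ?_⟩
    · calc (e * g ^ (k + 1) + b) * (2 * g) + 2 * e * g * g ^ (k + 1)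
          = (2 * g) * (b + 2 * e * g * g ^ k) := by ring
        _ = _ := by rw [hb]; ring
    · rw [TT]
      refine (Finset.card_filter_le _ _).trans (Finset.card_image_le.trans ?_)
      rw [Fintype.card_piFinset_const, pow_mul n0]
      apply Nat.pow_le_pow_left
      refine (Finset.card_biUnion_le_card_mul _ _ _ (fun y _ => hc y)).trans ?_
      rw [pow_add n0 (e * g ^ (k + 1)) b]
      refine Nat.mul_le_mul_right _ ((hbl3 x (k + 1)).trans (le_of_eq ?_))
      rw [← pow_mul, Nat.mul_comm]

lemma TT_supp {G : SimpleGraph V} (hG : G.Connected) {bl : V → ℕ → Finset V} {n0 g M : ℕ}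
    (hbl : ∀ x n y, y ∈ bl x n ↔ G.dist x y ≤ n)
    (h4 : ∀ k, 4 * n0 ^ (g ^ k) ≤ n0 ^ (g ^ (k + 1))) (k : ℕ) :
    ∀ x, ∀ F ∈ TT bl n0 g M k x, ∀ v ∈ F, G.dist x v ≤ 4 * n0 ^ (g ^ k) := by
  classical
  induction k with
  | zero =>
    intro x F hF v hv
    simp only [TT, Finset.mem_image] at hF
    obtain ⟨y, hy, rfl⟩ := hF
    rw [Finset.mem_singleton] at hv
    subst hv
    simpa using (hbl _ _ _).mp hy
  | succ k ih =>
    intro x F hF v hv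
    simp only [TT, Finset.mem_filter, Finset.mem_image, Fintype.mem_piFinset,
      Finset.mem_biUnion] at hF
    obtain ⟨⟨f, hf, rfl⟩, -⟩ := hF
    simp only [Finset.mem_biUnion, Finset.mem_univ, true_and] at hv
    obtain ⟨i, hi⟩ := hv
    obtain ⟨y, hy, hy'⟩ := hf i
    have h1 := ih y _ hy' v hi
    have h2 := (hbl _ _ _).mp hy
    have h3 := hG.dist_triangle (u := x) (v := y) (w := v)
    have := h4 k
    omega

lemma TT_good {G : SimpleGraph V} (hG : G.Connected) [Infinite V]
    (hfin : ∀ x n, (NB G x n).Finite) {bl : V → ℕ → Finset V} {n0 g M D e : ℕ}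
    (hbl : ∀ x n y, y ∈ bl x n ↔ G.dist x y ≤ n) (hn0 : ∀ k, 2 ≤ n0 ^ (g ^ k))
    (h4 : ∀ k, 4 * n0 ^ (g ^ k) ≤ n0 ^ (g ^ (k + 1)))
    (hdeg : ∀ x, ({y | G.Adj x y} : Set V).Finite ∧ ({y | G.Adj x y} : Set V).ncard ≤ D)
    (hvol : ∀ x k, M * (bl x (8 * n0 ^ (g ^ k))).card ≤ (n0 ^ (g ^ k)) ^ e)
    (hm : ∀ k, 2 * (n0 ^ (g ^ k)) ^ e ≤ n0 ^ (g ^ (k + 1)))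
    (hiso : ∀ x k, ∀ U ⊆ NB G x (3 * n0 ^ (g ^ (k + 1))),
      2 * U.ncard ≤ (NB G x (3 * n0 ^ (g ^ (k + 1)))).ncard → n0 ^ (g ^ (k + 1)) ≤ 2 * U.ncard →
      D * (n0 ^ (g ^ k)) ^ e < (relBoundary G U (NB G x (3 * n0 ^ (g ^ (k + 1))))).ncard)
    (ω : V → Bool) (k : ℕ) :
    ∀ x, (∀ F ∈ TT bl n0 g M k x, ∃ v ∈ F, ω v = true) → Good G ω x (n0 ^ (g ^ k)) := by
  classical
  induction k with
  | zero =>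
    intro x h
    apply good_base hG
    intro v hv
    obtain ⟨w, hw, hw'⟩ := h {v} (by
      simp only [TT, Finset.mem_image]
      exact ⟨v, (hbl _ _ _).mpr (by simpa using hv), rfl⟩)
    rw [Finset.mem_singleton] at hw
    exact hw ▸ hw'
  | succ k ih =>
    intro x h
    set Bad : Set V := {y | y ∈ NB G x (3 * n0 ^ (g ^ (k + 1))) ∧
      ∃ F ∈ TT bl n0 g M k y, ∀ v ∈ F, ω v = false} with hBad
    rcases greedy G (8 * n0 ^ (g ^ k)) Bad M with ⟨S, hS1, hS2, hS3⟩ | ⟨S, hS1, hS2⟩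
    · exfalso
      let eq := S.equivFinOfCardEq hS2
      let y : Fin M → V := fun i => (eq.symm i : V)
      have hy : ∀ i, y i ∈ Bad := fun i => hS1 _ (eq.symm i).2
      have hyinj : ∀ i j, i ≠ j → 8 * n0 ^ (g ^ k) < G.dist (y i) (y j) := by
        intro i j hij
        apply hS3 _ (eq.symm i).2 _ (eq.symm j).2
        intro h'
        exact hij (eq.symm.injective (Subtype.ext h'))
      choose f hf1 hf2 using fun i => (hy i).2
      have hmem : (Finset.univ.biUnion f) ∈ TT bl n0 g M (k + 1) x := by
        simp only [TT, Finset.mem_filter, Finset.mem_image, Fintype.mem_piFinset,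
          Finset.mem_biUnion]
        refine ⟨⟨f, fun i => ⟨y i, (hbl _ _ _).mpr (hy i).1, hf1 i⟩, rfl⟩, ?_⟩
        rw [Finset.card_biUnion]
        · rw [Finset.sum_congr rfl (fun i _ => TT_card (hf1 i))]
          simp [pow_succ, Nat.mul_comm]
        · intro i _ j _ hij
          rw [Function.onFun, Finset.disjoint_left]
          intro v hvi hvj
          have h1 := TT_supp hG hbl h4 k _ _ (hf1 i) v hvi
          have h2 := TT_supp hG hbl h4 k _ _ (hf1 j) v hvj
          have h3 := hG.dist_triangle (u := y i) (v := v) (w := y j)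
          rw [SimpleGraph.dist_comm (u := v)] at h3
          have := hyinj i j hij
          omega
      obtain ⟨v, hv, hv'⟩ := h _ hmem
      simp only [Finset.mem_biUnion, Finset.mem_univ, true_and] at hv
      obtain ⟨i, hi⟩ := hv
      simp [hf2 i v hi] at hv'
    · let Zf : Finset V := S.biUnion (fun s => bl s (8 * n0 ^ (g ^ k)))
      have hz : (Zf : Set V).ncard ≤ (n0 ^ (g ^ k)) ^ e := by
        rw [Set.ncard_coe_finset]
        rcases S.eq_empty_or_nonempty with rfl | ⟨s0, hs0⟩
        · simp [Zf]
        have hMpos : 0 < M := lt_of_lt_of_le (Finset.card_pos.mpr ⟨s0, hs0⟩) hS1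
        refine (Finset.card_biUnion_le_card_mul _ _ ((n0 ^ (g ^ k)) ^ e / M) ?_).trans ?_
        · intro s _
          rw [Nat.le_div_iff_mul_le hMpos, Nat.mul_comm]
          exact hvol s k
        · exact (Nat.mul_le_mul_right _ hS1).trans (Nat.mul_div_le _ _)
      refine renorm hG hfin (hn0 k) (h4 k) D ((n0 ^ (g ^ k)) ^ e) (Finset.finite_toSet Zf) hz hdeg
        (hiso x k) (hm k) ?_
      intro y hy hyZ
      apply ih y
      by_contra hcon
      push Not at hcon
      obtain ⟨F, hF, hF'⟩ := hcon
      have hyB : y ∈ Bad := ⟨hy, F, hF, fun v hv => by simpa using hF' v hv⟩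
      obtain ⟨s, hs, hsy⟩ := hS2 y hyB
      apply hyZ
      simp only [Zf, Finset.mem_coe, Finset.mem_biUnion]
      exact ⟨s, hs, (hbl _ _ _).mpr hsy⟩

lemma openCluster_mem {G : SimpleGraph V} {ω : V → Bool} {x y : V} (p : G.Walk x y)
    (hp : ∀ v ∈ p.support, ω v = true) : ∀ v ∈ p.support, v ∈ openCluster G ω x := by
  classical
  intro v hv
  exact ⟨hp x p.start_mem_support, p.takeUntil v hv, fun w hw =>
    hp w (p.support_takeUntil_subset_support hv hw)⟩

lemma openCluster_open {G : SimpleGraph V} {ω : V → Bool} {x y : V}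
    (h : y ∈ openCluster G ω x) : ω y = true := by
  obtain ⟨_, p, hp⟩ := h
  exact hp y p.end_mem_support

lemma openCluster_symm {G : SimpleGraph V} {ω : V → Bool} {x y : V}
    (h : y ∈ openCluster G ω x) : x ∈ openCluster G ω y := by
  have h0 := openCluster_open h
  obtain ⟨_, p, hp⟩ := h
  exact ⟨h0, p.reverse, by simpa using hp⟩

lemma openCluster_trans {G : SimpleGraph V} {ω : V → Bool} {x y z : V}
    (h : y ∈ openCluster G ω x) (h' : z ∈ openCluster G ω y) : z ∈ openCluster G ω x := by
  obtain ⟨h0, p, hp⟩ := h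
  obtain ⟨_, q, hq⟩ := h'
  refine ⟨h0, p.append q, ?_⟩
  intro v hv
  rw [SimpleGraph.Walk.mem_support_append_iff] at hv
  rcases hv with hv | hv
  · exact hp v hv
  · exact hq v hv

lemma openCluster_PC {G : SimpleGraph V} {ω : V → Bool} {x : V} : PC G (openCluster G ω x) := by
  intro a ha b hb
  obtain ⟨_, p, hp⟩ := openCluster_trans (openCluster_symm ha) hb
  exact ⟨p, fun v hv => openCluster_trans ha (openCluster_mem p hp v hv)⟩

lemma final_det {G : SimpleGraph V} (hG : G.Connected) [Infinite V]
    (hfin : ∀ x n, (NB G x n).Finite) {ω : V → Bool} {N : ℕ → ℕ} (hN2 : ∀ k, 2 ≤ N k)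
    (hNk : ∀ k, k ≤ N k) (h4 : ∀ k, 4 * N k ≤ N (k + 1)) (o : V) (k0 : ℕ)
    (hgood : ∀ k, k0 ≤ k → ∀ y ∈ NB G o (2 * N (k + 1)), Good G ω y (N k)) :
    UniqueInfCluster G ω := by
  constructor
  · -- existence
    set K : Set V := NB G o (N k0) with hK
    set O : Set V := {v | ω v = true} with hO
    set C : Set V := RS G K O with hC
    have hCp : PC G C := RS_PC (NB_PC hG _ _)
    have hKC : K ⊆ C := fun a ha => Reach.base a ha
    have hoC : o ∈ C := hKC (by simp [hK, NB])
    have hCc : ∀ v ∈ C, ∀ u, G.Adj v u → u ∈ O → u ∈ C :=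
      fun v hv u h1 h2 => Reach.step v u hv h1 h2
    have hsize : ∀ k, k0 ≤ k → (N k : ℕ∞) ≤ C.encard := by
      intro k hk
      induction k, hk using Nat.le_induction with
      | base => exact (NB_size hG hfin o (N k0)).trans (Set.encard_le_encard hKC)
      | succ k hk ih =>
        obtain ⟨b, hb⟩ := exists_far hfin o (2 * N (k + 1))
        have hu : PC G Set.univ := fun a _ b _ => by
          obtain ⟨p⟩ := hG.preconnected a b
          exact ⟨p, by simp⟩
        obtain ⟨p0, -⟩ := hu o (Set.mem_univ _) b (Set.mem_univ _)
        obtain ⟨z, -, hz⟩ := ivt hG o (2 * N (k + 1)) p0 (by simp) hb.le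
        obtain ⟨p, hp⟩ := NB_walk hG o (2 * N (k + 1)) (y := z) hz.le
        have key : ∀ (a b : V) (p : G.Walk a b), (∀ v ∈ p.support, v ∈ NB G o (2 * N (k + 1))) →
            (∃ c ∈ C, G.dist a c ≤ 2 * N k) → ∃ c ∈ C, G.dist b c ≤ 2 * N k := by
          intro a b p
          induction p with
          | nil => exact fun _ h => h
          | @cons u v w h p ihp =>
            intro hp hc
            refine ihp (fun x hx => hp x (by simp [hx])) ?_
            exact chain_step hG hfin (hN2 k) (hgood k hk u (hp u (by simp))) hCp hCc ih hc
              (fun v hv _ => hv) h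
        obtain ⟨c, hc, hcz⟩ := key o z p hp ⟨o, hoC, by simp⟩
        have h1 := hG.dist_triangle (u := o) (v := c) (w := z)
        rw [SimpleGraph.dist_comm (u := c)] at h1
        have h2 := h4 k
        have := size_far hG o 0 (N (k + 1)) hCp hoC (by simp) hc (by omega)
        exact this.trans (Set.encard_le_encard Set.inter_subset_left)
    have hinf : C.Infinite := by
      intro hCf
      have h1 := hsize (k0 + C.ncard + 1) (by omega)
      rw [← hCf.cast_ncard_eq] at h1
      have h2 : N (k0 + C.ncard + 1) ≤ C.ncard := by exact_mod_cast h1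
      have := hNk (k0 + C.ncard + 1)
      omega
    by_contra hno
    push Not at hno
    have hsub : C ⊆ K ∪ ⋃ w ∈ NB G o (N k0 + 1), openCluster G ω w := by
      intro v hv
      have hv : Reach G K O v := hv
      induction hv with
      | base v h => exact Or.inl h
      | step v u _ hadj hu ih =>
        right
        rw [Set.mem_iUnion₂]
        rcases ih (by assumption) with h | h
        · refine ⟨u, ?_, hu, SimpleGraph.Walk.nil, ?_⟩
          · have h1 := hG.dist_triangle (u := o) (v := v) (w := u)
            have h2 : G.dist v u = 1 := SimpleGraph.dist_eq_one_iff_adj.mpr hadj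
            have h3 : G.dist o v ≤ N k0 := h
            show G.dist o u ≤ N k0 + 1
            omega
          · intro w hw
            rw [SimpleGraph.Walk.mem_support_nil_iff] at hw
            subst hw
            exact hu
        · rw [Set.mem_iUnion₂] at h
          obtain ⟨w, hw, hvw⟩ := h
          refine ⟨w, hw, openCluster_trans hvw ⟨openCluster_open hvw, hadj.toWalk, ?_⟩⟩
          intro t ht
          simp only [SimpleGraph.Adj.toWalk, SimpleGraph.Walk.support_cons,
            SimpleGraph.Walk.support_nil, List.mem_cons, List.not_mem_nil, or_false] at ht
          rcases ht with rfl | rfl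
          · exact openCluster_open hvw
          · exact hu
    apply hinf
    refine Set.Finite.subset ((hfin o (N k0)).union ((hfin o _).biUnion fun w _ => ?_)) hsub
    exact hno w
  · intro x y hx hy
    have hcl : ∀ {x : V}, (openCluster G ω x).Infinite → x ∈ openCluster G ω x := by
      intro x hx
      obtain ⟨z, hz⟩ := hx.nonempty
      exact openCluster_trans hz (openCluster_symm hz)
    set k := k0 + G.dist o x + G.dist o y with hk
    have hNk' := hNk k
    obtain ⟨a, ha, b, hb, p, hp⟩ := hgood k (by omega) o (by simp [NB]) _ _
      (openCluster_PC (x := x)) (openCluster_PC (x := y)) (by rw [hx.encard_eq]; exact le_top)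
      (by rw [hy.encard_eq]; exact le_top) ⟨x, hcl hx, by omega⟩ ⟨y, hcl hy, by omega⟩
    have hab : b ∈ openCluster G ω a := ⟨openCluster_open ha, p, fun v hv => by
      rcases hp v hv with h | h | h
      · exact openCluster_open h
      · exact openCluster_open h
      · exact h.1⟩
    have hxy : y ∈ openCluster G ω x :=
      openCluster_trans (openCluster_trans ha hab) (openCluster_symm hb)
    ext z
    exact ⟨fun h => openCluster_trans (openCluster_symm hxy) h, fun h => openCluster_trans hxy h⟩

/-- Probability of a witness event. -/
lemma prob_bad {P : Measure (V → Bool)} {p : ℝ} (hP : IsBernoulli P p) (T : Finset (Finset V))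
    (m : ℕ) (hT : ∀ F ∈ T, F.card = m) :
    P {ω | ∃ F ∈ T, ∀ v ∈ F, ω v = false} ≤ T.card * ENNReal.ofReal ((1 - p) ^ m) := by
  have h1 : {ω : V → Bool | ∃ F ∈ T, ∀ v ∈ F, ω v = false} =
      ⋃ F ∈ T, {ω | ∀ v ∈ F, ω v = false} := by
    ext ω; simp
  rw [h1]
  refine (measure_biUnion_finset_le _ _).trans ?_
  rw [← nsmul_eq_mul]
  refine Finset.sum_le_card_nsmul _ _ _ fun F hF => ?_
  have := hP F (fun _ => false)
  rw [this]
  simp [hT F hF]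

lemma prob_step {P : Measure (V → Bool)} {p : ℝ} (hP : IsBernoulli P p)
    {bl : V → ℕ → Finset V} {n0 g e : ℕ} (hg : 1 ≤ g) (hn0 : 1 ≤ n0)
    (hbl : ∀ x k, (bl x (4 * n0 ^ (g ^ k))).card ≤ (n0 ^ (g ^ k)) ^ e)
    (hbl3 : ∀ x k, (bl x (3 * n0 ^ (g ^ k))).card ≤ (n0 ^ (g ^ k)) ^ e)
    (hbl2 : ∀ x k, (bl x (2 * n0 ^ (g ^ k))).card ≤ (n0 ^ (g ^ k)) ^ e)
    (hp1 : p ≤ 1) (hp : (n0 : ℝ) ^ (e * g + (e + 2 * e * g)) * (1 - p) ≤ 1 / 2) (o : V) (k : ℕ) :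
    P {ω | ∃ y ∈ bl o (2 * n0 ^ (g ^ (k + 1))), ∃ F ∈ TT bl n0 g (2 * g) k y,
      ∀ v ∈ F, ω v = false} ≤ ENNReal.ofReal ((1 / 2) ^ k) := by
  classical
  obtain ⟨b, hb, hc⟩ := TT_count hg hbl hbl3 k
  set T := (bl o (2 * n0 ^ (g ^ (k + 1)))).biUnion (TT bl n0 g (2 * g) k) with hT
  have h1 : {ω : V → Bool | ∃ y ∈ bl o (2 * n0 ^ (g ^ (k + 1))), ∃ F ∈ TT bl n0 g (2 * g) k y,
      ∀ v ∈ F, ω v = false} = {ω | ∃ F ∈ T, ∀ v ∈ F, ω v = false} := by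
    ext ω
    simp only [hT, Finset.mem_biUnion, Set.mem_ofPred_eq]
    constructor
    · rintro ⟨y, hy, F, hF, h⟩; exact ⟨F, ⟨y, hy, hF⟩, h⟩
    · rintro ⟨F, ⟨y, hy, hF⟩, h⟩; exact ⟨y, hy, F, hF, h⟩
  rw [h1]
  refine (prob_bad hP T ((2 * g) ^ k) ?_).trans ?_
  · intro F hF
    obtain ⟨y, _, hF⟩ := Finset.mem_biUnion.mp hF
    exact TT_card hF
  have hTc : T.card ≤ (n0 ^ (e * g + (e + 2 * e * g))) ^ ((2 * g) ^ k) := by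
    refine (Finset.card_biUnion_le_card_mul _ _ _ (fun y _ => hc y)).trans ?_
    refine (Nat.mul_le_mul_right _ (hbl2 o (k + 1))).trans ?_
    rw [← pow_mul, ← pow_add, ← pow_mul]
    apply Nat.pow_le_pow_right hn0
    have h2 : g ^ k ≤ (2 * g) ^ k := Nat.pow_le_pow_left (by omega) k
    calc g ^ (k + 1) * e + b ≤ (e * g) * g ^ k + (b + 2 * e * g * g ^ k) := by
          have : g ^ (k + 1) * e = (e * g) * g ^ k := by ring
          omega
      _ ≤ (e * g) * (2 * g) ^ k + (e + 2 * e * g) * (2 * g) ^ k := by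
          rw [hb]
          exact Nat.add_le_add_right (Nat.mul_le_mul_left _ h2) _
      _ = _ := by ring
  have hq : 0 ≤ 1 - p := by linarith
  rw [← ENNReal.ofReal_natCast, ← ENNReal.ofReal_mul (by positivity)]
  apply ENNReal.ofReal_le_ofReal
  calc (T.card : ℝ) * (1 - p) ^ ((2 * g) ^ k)
      ≤ (((n0 ^ (e * g + (e + 2 * e * g))) ^ ((2 * g) ^ k) : ℕ) : ℝ) * (1 - p) ^ ((2 * g) ^ k) := by
        gcongr
    _ = ((n0 : ℝ) ^ (e * g + (e + 2 * e * g)) * (1 - p)) ^ ((2 * g) ^ k) := by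
        push_cast; exact (mul_pow _ _ _).symm
    _ ≤ (1 / 2) ^ ((2 * g) ^ k) := by
        gcongr
    _ ≤ (1 / 2) ^ k := by
        apply pow_le_pow_of_le_one (by norm_num) (by norm_num)
        exact (Nat.lt_pow_self (by omega : 1 < 2 * g)).le

lemma arith (di ci du cu : ℝ) (hdi : 1 < di) (hci : 0 < ci) (hdu : 1 < du) (hcu : 0 < cu) :
    ∃ e g D n0 : ℕ, 2 ≤ g ∧ 4 ≤ n0 ∧ cu ≤ D ∧ ∀ n : ℕ, n0 ≤ n →
      (2 * g : ℝ) * (cu * (8 * n : ℝ) ^ du) ≤ (n : ℝ) ^ e ∧ 2 * n ^ e ≤ n ^ g ∧ 4 * n ≤ n ^ g ∧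
      ∀ m : ℕ, n ^ g ≤ 2 * m → (D : ℝ) * (n : ℝ) ^ e < ci * (m : ℝ) ^ ((di - 1) / di) := by
  set θ : ℝ := (di - 1) / di with hθ
  have hθ0 : 0 < θ := div_pos (by linarith) (by linarith)
  have hθ1 : θ ≤ 1 := by rw [hθ, div_le_one (by linarith)]; linarith
  set e : ℕ := ⌈du⌉₊ + 1 with he
  have hedu : du + 1 ≤ (e : ℝ) := by
    rw [he]; push_cast; linarith [Nat.le_ceil du]
  set g : ℕ := ⌈((e : ℝ) + 1) / θ⌉₊ + (e + 1) with hg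
  have hgθ : (e : ℝ) + 1 ≤ g * θ := by
    rw [← div_le_iff₀ hθ0, hg]
    push_cast
    have := Nat.le_ceil (((e : ℝ) + 1) / θ)
    have : (0 : ℝ) ≤ e := by positivity
    linarith
  have hge : e + 1 ≤ g := by omega
  set D : ℕ := ⌈cu⌉₊ with hD
  set n0 : ℕ := 4 + ⌈(2 * g : ℝ) * cu * 8 ^ du⌉₊ + ⌈2 * D / ci⌉₊ with hn0
  refine ⟨e, g, D, n0, by omega, by omega, Nat.le_ceil cu, ?_⟩
  intro n hn
  have hn4 : 4 ≤ n := by omega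
  have hnR : (4 : ℝ) ≤ n := by exact_mod_cast hn4
  have hnn : (n0 : ℝ) ≤ n := by exact_mod_cast hn
  have hn0R : (n0 : ℝ) = 4 + ⌈(2 * g : ℝ) * cu * 8 ^ du⌉₊ + ⌈2 * D / ci⌉₊ := by
    rw [hn0]; push_cast; ring
  have hc1 := Nat.le_ceil ((2 * g : ℝ) * cu * 8 ^ du)
  have hc2 := Nat.le_ceil (2 * D / ci)
  have hp1 : (0 : ℝ) ≤ (⌈(2 * g : ℝ) * cu * 8 ^ du⌉₊ : ℝ) := by positivity
  have hp2 : (0 : ℝ) ≤ (⌈2 * D / ci⌉₊ : ℝ) := by positivity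
  have hnpos : (0 : ℝ) < n := by linarith
  have hpe : (n : ℝ) ^ e * n ≤ (n : ℝ) ^ ((g : ℝ) * θ) := by
    have : (n : ℝ) ^ e * n = (n : ℝ) ^ ((e : ℝ) + 1) := by
      rw [Real.rpow_add hnpos, Real.rpow_one, Real.rpow_natCast]
    rw [this]
    exact Real.rpow_le_rpow_of_exponent_le (by linarith) hgθ
  refine ⟨?_, ?_, ?_, ?_⟩
  · rw [Real.mul_rpow (by norm_num) hnpos.le]
    calc (2 * g : ℝ) * (cu * (8 ^ du * (n : ℝ) ^ du))
        = ((2 * g : ℝ) * cu * 8 ^ du) * (n : ℝ) ^ du := by ring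
      _ ≤ n * (n : ℝ) ^ du := by
          gcongr
          linarith
      _ = (n : ℝ) ^ (du + 1) := by rw [Real.rpow_add hnpos, Real.rpow_one]; ring
      _ ≤ (n : ℝ) ^ (e : ℝ) := Real.rpow_le_rpow_of_exponent_le (by linarith) hedu
      _ = _ := Real.rpow_natCast _ _
  · calc 2 * n ^ e ≤ n * n ^ e := Nat.mul_le_mul_right _ (by omega)
      _ = n ^ (e + 1) := by ring
      _ ≤ n ^ g := Nat.pow_le_pow_right (by omega) hge
  · calc 4 * n ≤ n * n := Nat.mul_le_mul_right _ hn4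
      _ = n ^ 2 := by ring
      _ ≤ n ^ g := Nat.pow_le_pow_right (by omega) (by omega)
  · intro m hm
    have hmR : (n : ℝ) ^ g * (1 / 2) ≤ m := by
      have : ((n ^ g : ℕ) : ℝ) ≤ ((2 * m : ℕ) : ℝ) := by exact_mod_cast hm
      push_cast at this
      linarith
    have h1 : ((n : ℝ) ^ e * n) * (1 / 2) ≤ (m : ℝ) ^ θ := by
      calc ((n : ℝ) ^ e * n) * (1 / 2) ≤ (n : ℝ) ^ ((g : ℝ) * θ) * (1 / 2 : ℝ) ^ θ := by
            gcongr
            calc (1 / 2 : ℝ) = (1 / 2 : ℝ) ^ (1 : ℝ) := (Real.rpow_one _).symm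
              _ ≤ (1 / 2 : ℝ) ^ θ :=
                Real.rpow_le_rpow_of_exponent_ge (by norm_num) (by norm_num) hθ1
        _ = ((n : ℝ) ^ g * (1 / 2)) ^ θ := by
            rw [Real.mul_rpow (by positivity) (by norm_num), Real.rpow_mul hnpos.le,
              Real.rpow_natCast]
        _ ≤ (m : ℝ) ^ θ := Real.rpow_le_rpow (by positivity) hmR hθ0.le
    have h2 : 2 * D / ci < n := by linarith
    rw [div_lt_iff₀ hci] at h2
    have h3 : (0 : ℝ) < (n : ℝ) ^ e := by positivity
    nlinarith [mul_le_mul_of_nonneg_left h1 hci.le, mul_lt_mul_of_pos_left h2 h3]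

end PercAux

/-- For all `dᵢ > 1, cᵢ > 0, dᵤ > 1, cᵤ > 0` there exists `p⋆ < 1`
(depending only on these constants) such that for every infinite, connected, locally
finite graph satisfying `L(dᵢ,cᵢ)` and `𝒱ᵤ(dᵤ,cᵤ)`, and every `p` with `p⋆ < p ≤ 1`,
the Bernoulli product measure `P_p` gives probability one to the event that there
exists exactly one infinite open cluster. -/
theorem statement0 :
    ∀ (di ci du cu : ℝ), 1 < di → 0 < ci → 1 < du → 0 < cu →
    ∃ pstar : ℝ, pstar < 1 ∧
      ∀ (V : Type u) (G : SimpleGraph V), Infinite V → G.Connected →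
        (∀ v : V, (G.neighborSet v).Finite) →
        LocalIso G di ci → VolUpper G du cu →
        ∀ p : ℝ, pstar < p → p ≤ 1 →
          ∀ P : Measure (V → Bool), IsProbabilityMeasure P → IsBernoulli P p →
            P {ω | UniqueInfCluster G ω} = 1 := by
  classical
  intro di ci du cu hdi hci hdu hcu
  obtain ⟨e, g, D, n0, hg, hn0, hD, harith⟩ := PercAux.arith di ci du cu hdi hci hdu hcu
  set Q : ℝ := (n0 : ℝ) ^ (e * g + (e + 2 * e * g)) with hQ
  have hQ0 : 0 < Q := by
    have : (0 : ℝ) < n0 := by exact_mod_cast (by omega : 0 < n0)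
    positivity
  refine ⟨1 - 1 / (2 * Q), by
    have : 0 < 1 / (2 * Q) := by positivity
    linarith, ?_⟩
  intro V G hinf hG _ hiso hvol p hp hp1 P hPp hPB
  have hfin : ∀ x n, (PercAux.NB G x n).Finite := by
    intro x n
    have h1 := (hvol x ((n + 1 : ℕ) : ℝ) (by push_cast; linarith [n.cast_nonneg (α := ℝ)])).1
    rw [PercAux.gball_eq hG] at h1
    refine h1.subset fun y hy => ?_
    exact le_trans (show G.dist x y ≤ n from hy) (Nat.le_succ n)
  let bl : V → ℕ → Finset V := fun x n => (hfin x n).toFinset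
  have hbl : ∀ x n y, y ∈ bl x n ↔ G.dist x y ≤ n := by
    intro x n y
    simp [bl, PercAux.NB]
  have hblc : ∀ x n, 1 ≤ n → ((bl x n).card : ℝ) ≤ cu * (n : ℝ) ^ du := by
    intro x n hn
    have h1 := (hvol x (n : ℝ) (by exact_mod_cast hn)).2
    rw [PercAux.gball_eq hG, Set.ncard_eq_toFinset_card _ (hfin x n)] at h1
    exact h1
  have hblm : ∀ x m n, m ≤ n → (bl x m).card ≤ (bl x n).card := by
    intro x m n hmn
    apply Finset.card_le_card
    intro y hy
    rw [hbl] at hy ⊢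
    omega
  -- the scales
  have hNge : ∀ k, n0 ≤ n0 ^ (g ^ k) := fun k =>
    Nat.le_self_pow (pow_ne_zero _ (by omega)) n0
  have hNs : ∀ k, n0 ^ (g ^ (k + 1)) = (n0 ^ (g ^ k)) ^ g := by
    intro k; rw [← pow_mul, pow_succ]
  have h4 : ∀ k, 4 * n0 ^ (g ^ k) ≤ n0 ^ (g ^ (k + 1)) := by
    intro k; rw [hNs]; exact (harith _ (hNge k)).2.2.1
  have hm : ∀ k, 2 * (n0 ^ (g ^ k)) ^ e ≤ n0 ^ (g ^ (k + 1)) := by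
    intro k; rw [hNs]; exact (harith _ (hNge k)).2.1
  have hN2 : ∀ k, 2 ≤ n0 ^ (g ^ k) := fun k => by have := hNge k; omega
  have hNk : ∀ k, k ≤ n0 ^ (g ^ k) := by
    intro k
    have h1 : k < g ^ k := Nat.lt_pow_self (by omega)
    have h2 : g ^ k < n0 ^ (g ^ k) := Nat.lt_pow_self (by omega)
    omega
  have hvol' : ∀ x k, (2 * g) * (bl x (8 * n0 ^ (g ^ k))).card ≤ (n0 ^ (g ^ k)) ^ e := by
    intro x k
    have h1 := (harith _ (hNge k)).1
    have h2 := hblc x (8 * n0 ^ (g ^ k)) (by have := hN2 k; omega)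
    have h3 : (2 * g : ℝ) * ((bl x (8 * n0 ^ (g ^ k))).card : ℝ) ≤
        ((n0 ^ (g ^ k) : ℕ) : ℝ) ^ e := by
      refine le_trans ?_ h1
      gcongr
      refine h2.trans (le_of_eq ?_)
      push_cast
      rfl
    exact_mod_cast h3
  have hsm : ∀ (j : ℕ), j ≤ 8 → ∀ x k, (bl x (j * n0 ^ (g ^ k))).card ≤ (n0 ^ (g ^ k)) ^ e := by
    intro j hj x k
    refine (hblm x _ _ (Nat.mul_le_mul_right _ hj)).trans ?_
    refine le_trans ?_ (hvol' x k)
    exact Nat.le_mul_of_pos_left _ (by omega)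
  have hdeg : ∀ x, ({y | G.Adj x y} : Set V).Finite ∧ ({y | G.Adj x y} : Set V).ncard ≤ D := by
    intro x
    have hsub : ({y | G.Adj x y} : Set V) ⊆ (bl x 1 : Set V) := by
      intro y hy
      rw [Finset.mem_coe, hbl]
      exact (SimpleGraph.dist_eq_one_iff_adj.mpr hy).le
    refine ⟨(Finset.finite_toSet _).subset hsub, ?_⟩
    refine (Set.ncard_le_ncard hsub (Finset.finite_toSet _)).trans ?_
    rw [Set.ncard_coe_finset]
    have h1 := hblc x 1 le_rfl
    simp only [Nat.cast_one, Real.one_rpow, mul_one] at h1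
    exact_mod_cast h1.trans hD
  have hiso' : ∀ x k, ∀ U ⊆ PercAux.NB G x (3 * n0 ^ (g ^ (k + 1))),
      2 * U.ncard ≤ (PercAux.NB G x (3 * n0 ^ (g ^ (k + 1)))).ncard →
      n0 ^ (g ^ (k + 1)) ≤ 2 * U.ncard →
      D * (n0 ^ (g ^ k)) ^ e <
        (relBoundary G U (PercAux.NB G x (3 * n0 ^ (g ^ (k + 1))))).ncard := by
    intro x k U hU h1 h2
    have h3 := hiso x ((3 * n0 ^ (g ^ (k + 1)) : ℕ) : ℝ)
      (by exact_mod_cast (by have := hN2 (k + 1); omega : 1 ≤ 3 * n0 ^ (g ^ (k + 1)))) U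
    rw [PercAux.gball_eq hG] at h3
    have h1' : ((2 * U.ncard : ℕ) : ℝ) ≤
        ((PercAux.NB G x (3 * n0 ^ (g ^ (k + 1)))).ncard : ℝ) := by exact_mod_cast h1
    push_cast at h1'
    have h4 := h3 hU (by linarith)
    have h5 := (harith _ (hNge k)).2.2.2 U.ncard (by rw [← hNs]; exact h2)
    have h6 := h5.trans_le h4
    exact_mod_cast h6
  obtain ⟨o⟩ := hG.nonempty
  have hQp : Q * (1 - p) ≤ 1 / 2 := by
    have h1 : 1 - p ≤ 1 / (2 * Q) := by linarith
    calc Q * (1 - p) ≤ Q * (1 / (2 * Q)) := by gcongr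
      _ = 1 / 2 := by field_simp
  have hsum := PercAux.prob_step hPB (bl := bl) (n0 := n0) (g := g) (e := e) (by omega) (by omega)
    (hsm 4 (by omega)) (hsm 3 (by omega)) (hsm 2 (by omega)) hp1 hQp o
  have hBC := ae_eventually_notMem (μ := P) (s := fun k => {ω : V → Bool |
      ∃ y ∈ bl o (2 * n0 ^ (g ^ (k + 1))), ∃ F ∈ PercAux.TT bl n0 g (2 * g) k y,
      ∀ v ∈ F, ω v = false}) (by
    refine ne_top_of_le_ne_top ?_ (ENNReal.tsum_le_tsum hsum)
    rw [← ENNReal.ofReal_tsum_of_nonneg (fun k => by positivity)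
      (summable_geometric_of_lt_one (by norm_num) (by norm_num))]
    exact ENNReal.ofReal_ne_top)
  have hae : ∀ᵐ ω ∂P, UniqueInfCluster G ω := by
    filter_upwards [hBC] with ω hω
    obtain ⟨k0, hk0⟩ := eventually_atTop.mp hω
    refine PercAux.final_det hG hfin (N := fun k => n0 ^ (g ^ k)) hN2 hNk h4 o k0 ?_
    intro k hk y hy
    apply PercAux.TT_good hG hfin hbl hN2 h4 hdeg hvol' hm hiso' ω k y
    intro F hF
    by_contra hcon
    push Not at hcon
    exact hk0 k hk ⟨y, (hbl _ _ _).mpr hy, F, hF, fun v hv => by simpa using hcon v hv⟩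
  have huniv : ({ω | UniqueInfCluster G ω} : Set (V → Bool)) =ᵐ[P] Set.univ :=
    eventuallyEq_univ.mpr hae
  rw [measure_congr huniv]
  exact hPp.measure_univ
end

section
/- Let G = (V,E) be an infinite, connected, locally finite graph satisfying the local isoperimetric inequality L(d_i,c_i) and the volume upper bound V_u(d_u,c_u) for some d_i > 1, c_i > 0, d_u > 1, c_u > 0. Then the critical probability for site percolation, p_c := sup{ p ∈ [0,1] : P_p[there exists an infinite open cluster] = 0 }, satisfies p_c < 1. -/
open MeasureTheory Filter

universe u

variable {V : Type u}

/-- One step along an edge into `X`. -/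
def stepIn (G : SimpleGraph V) (X : Set V) (a b : V) : Prop := G.Adj a b ∧ b ∈ X

/-- `v` can be reached from `u` inside `X`. -/
def ReachIn (G : SimpleGraph V) (X : Set V) (u v : V) : Prop :=
  u ∈ X ∧ Relation.ReflTransGen (stepIn G X) u v

theorem ReachIn.refl {G : SimpleGraph V} {X : Set V} {u : V} (h : u ∈ X) : ReachIn G X u u :=
  ⟨h, .refl⟩

theorem ReachIn.tail {G : SimpleGraph V} {X : Set V} {u v w : V} (h : ReachIn G X u v)
    (ha : G.Adj v w) (hw : w ∈ X) : ReachIn G X u w :=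
  ⟨h.1, h.2.tail ⟨ha, hw⟩⟩

theorem ReachIn.right_mem {G : SimpleGraph V} {X : Set V} {u v : V} (h : ReachIn G X u v) :
    v ∈ X := by
  obtain ⟨h1, h2⟩ := h
  induction h2 with
  | refl => exact h1
  | tail _ h _ => exact h.2

theorem ReachIn.trans {G : SimpleGraph V} {X : Set V} {u v w : V} (h : ReachIn G X u v)
    (h' : ReachIn G X v w) : ReachIn G X u w :=
  ⟨h.1, h.2.trans h'.2⟩

theorem ReachIn.symm {G : SimpleGraph V} {X : Set V} {u v : V} (h : ReachIn G X u v) :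
    ReachIn G X v u := by
  obtain ⟨h1, h2⟩ := h
  induction h2 with
  | refl => exact .refl h1
  | tail h3 h ih =>
    exact ((ReachIn.refl h.2).tail h.1.symm (ReachIn.right_mem ⟨h1, h3⟩)).trans ih

theorem ReachIn.mono {G : SimpleGraph V} {X Y : Set V} (hXY : X ⊆ Y) {u v : V}
    (h : ReachIn G X u v) : ReachIn G Y u v :=
  ⟨hXY h.1, Relation.ReflTransGen.mono (p := stepIn G Y) (fun _ _ h => ⟨h.1, hXY h.2⟩) _ _ h.2⟩

theorem dist_step {G : SimpleGraph V} (hc : G.Connected) {u v w : V} (h : G.Adj v w) :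
    G.dist u w ≤ G.dist u v + 1 := by
  have := hc.dist_triangle (u := u) (v := v) (w := w)
  rw [SimpleGraph.dist_eq_one_iff_adj.2 h] at this
  exact this

theorem trunc {G : SimpleGraph V} (hc : G.Connected) {X : Set V} {w v : V} {s : ℕ}
    (h : ReachIn G X w v) (hs : s ≤ G.dist w v) :
    ∃ v', ReachIn G (X ∩ {y | G.dist w y ≤ s}) w v' ∧ G.dist w v' = s := by
  by_contra hcon
  push Not at hcon
  have key : ∀ z, ReachIn G X w z →
      ReachIn G (X ∩ {y | G.dist w y ≤ s}) w z := by
    rintro z ⟨h1, h2⟩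
    induction h2 with
    | refl => exact .refl ⟨h1, by simp⟩
    | @tail b c hb hbc ih =>
      refine ih.tail hbc.1 ⟨hbc.2, ?_⟩
      have h3 := hcon _ ih
      have h4 : G.dist w b ≤ s := ih.right_mem.2
      have := dist_step hc (u := w) hbc.1
      simp only [Set.mem_ofPred_eq]
      omega
  have h5 := key v h
  have h6 : G.dist w v ≤ s := h5.right_mem.2
  exact hcon v h5 (le_antisymm h6 hs)

theorem reach_univ {G : SimpleGraph V} (hc : G.Connected) (u v : V) :
    ReachIn G Set.univ u v := by
  obtain ⟨p⟩ := hc u v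
  induction p with
  | nil => exact .refl trivial
  | cons h p ih => exact ((ReachIn.refl (Set.mem_univ _)).tail h (Set.mem_univ _)).trans ih

theorem reach_walk {G : SimpleGraph V} {X : Set V} {u v : V} (p : G.Walk u v)
    (h : ∀ w ∈ p.support, w ∈ X) : ReachIn G X u v := by
  induction p with
  | nil => exact .refl (h _ (by simp))
  | cons h' p ih =>
    refine ((ReachIn.refl (h _ (by simp))).tail h' (h _ ?_)).trans (ih ?_)
    · simp
    · intro w hw; exact h w (by simp [hw])

/-- Geodesics stay in balls. -/
theorem reach_ball {G : SimpleGraph V} (hc : G.Connected) (u : V) {v : V} {n : ℕ}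
    (h : G.dist u v ≤ n) : ReachIn G {y | G.dist u y ≤ n} u v := by
  classical
  obtain ⟨p, hp⟩ := hc.exists_walk_length_eq_dist u v
  apply reach_walk p
  intro w hw
  have h1 := SimpleGraph.dist_le (p.takeUntil w hw)
  have h2 := p.length_takeUntil_le_length hw
  simp only [Set.mem_ofPred_eq]
  omega

/-- Separation event. -/
def SepEv (G : SimpleGraph V) (ω : V → Bool) (x : V) (s : ℕ) : Prop :=
  ∃ C : Set V, (∀ u v, u ∈ C → v ∉ C → G.Adj u v → G.dist x v ≤ 6 * s → ω v = false) ∧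
    (∃ u v, ReachIn G (C ∩ {y | G.dist x y ≤ 3 * s}) u v ∧ s ≤ G.dist u v) ∧
    (∃ u v, ReachIn G {y | G.dist x y ≤ 3 * s ∧ y ∉ C ∧ ∀ c ∈ C, ¬ G.Adj c y} u v ∧
      s ≤ G.dist u v)

theorem SepEv.congr {G : SimpleGraph V} {ω ω' : V → Bool} {x : V} {s : ℕ}
    (h : ∀ v, G.dist x v ≤ 6 * s → ω v = ω' v) (hs : SepEv G ω x s) : SepEv G ω' x s := by
  obtain ⟨C, h1, h2, h3⟩ := hs
  exact ⟨C, fun u v hu hv ha hd => (h v hd).symm.trans (h1 u v hu hv ha hd), h2, h3⟩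

theorem SepEv.exists_closed {G : SimpleGraph V} (hc : G.Connected) {ω : V → Bool} {x : V} {s : ℕ}
    (hs : SepEv G ω x s) : ∃ v, G.dist x v ≤ 6 * s ∧ ω v = false := by
  obtain ⟨C, h1, ⟨u, v, h2, -⟩, ⟨u', v', h3, -⟩⟩ := hs
  by_contra hcon
  push Not at hcon
  have hr : ReachIn G {y | G.dist x y ≤ 3 * s} u u' :=
    (reach_ball hc x h2.1.2).symm.trans (reach_ball hc x h3.1.1)
  have key : ∀ z, ReachIn G {y | G.dist x y ≤ 3 * s} u z → z ∈ C := by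
    rintro z ⟨-, h⟩
    induction h with
    | refl => exact h2.1.1
    | @tail b c hb hbc ih =>
      by_contra hcC
      have h4 : G.dist x c ≤ 3 * s := hbc.2
      exact hcon c (by omega) (h1 b c ih hcC hbc.1 (by omega))
  exact h3.1.2.1 (key _ hr)

/-- If `C` comes close to `z` and has long arms, and some long set avoids the neighbourhood
of `C`, then `SepEv` occurs. -/
theorem mkSep {G : SimpleGraph V} (hc : G.Connected) {ω : V → Bool} {C : Set V} {s : ℕ}
    (hs : 1 ≤ s) (harm : ∀ w ∈ C, ∃ w', ReachIn G C w w' ∧ s ≤ G.dist w w') {y : V}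
    (hcl : ∀ u v, u ∈ C → v ∉ C → G.Adj u v → G.dist y v ≤ 6 * s → ω v = false)
    (hit : ∃ w ∈ C, G.dist y w ≤ s + 1) {z z' : V} (hz : G.dist y z ≤ 1)
    (hr : ReachIn G {y | y ∉ C ∧ ∀ c ∈ C, ¬ G.Adj c y} z z') (hd : s ≤ G.dist z z') :
    SepEv G ω y s := by
  refine ⟨C, hcl, ?_, ?_⟩
  · obtain ⟨w, hw, hyw⟩ := hit
    obtain ⟨w', h1, h2⟩ := harm w hw
    obtain ⟨v', h3, h4⟩ := trunc hc h1 h2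
    refine ⟨w, v', h3.mono ?_, h4.ge⟩
    rintro t ⟨ht1, ht2⟩
    refine ⟨ht1, ?_⟩
    have := hc.dist_triangle (u := y) (v := w) (w := t)
    simp only [Set.mem_ofPred_eq] at *
    omega
  · obtain ⟨v', h3, h4⟩ := trunc hc hr hd
    refine ⟨z, v', h3.mono ?_, h4.ge⟩
    rintro t ⟨ht1, ht2⟩
    refine ⟨?_, ht1⟩
    have := hc.dist_triangle (u := y) (v := z) (w := t)
    simp only [Set.mem_ofPred_eq] at *
    omega

theorem chain_step {G : SimpleGraph V} (hc : G.Connected)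
    (hinf : ∀ (x : V) (n : ℕ), ∃ y, n ≤ G.dist x y) {ω : V → Bool} {C : Set V} {s : ℕ}
    (hs : 1 ≤ s) (harm : ∀ w ∈ C, ∃ w', ReachIn G C w w' ∧ s ≤ G.dist w w') {y z : V}
    (hcl : ∀ u v, u ∈ C → v ∉ C → G.Adj u v → G.dist y v ≤ 6 * s → ω v = false)
    (hit : ∃ w ∈ C, G.dist y w ≤ s + 1) (hyz : G.Adj y z) (hns : ¬ SepEv G ω y s) :
    ∃ w ∈ C, G.dist z w ≤ s + 1 := by
  by_contra hcon
  push Not at hcon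
  obtain ⟨t, ht⟩ := hinf z s
  obtain ⟨t', h1, h2⟩ := trunc hc (reach_univ hc z t) ht
  apply hns
  refine mkSep hc hs harm hcl hit (SimpleGraph.dist_eq_one_iff_adj.2 hyz).le (h1.mono ?_) h2.ge
  rintro a ⟨-, ha⟩
  simp only [Set.mem_ofPred_eq] at ha
  refine ⟨fun haC => ?_, fun c hcC hadj => ?_⟩
  · have := hcon a haC; omega
  · have := hcon c hcC
    have := dist_step hc (u := z) hadj.symm
    omega

theorem arm_of {G : SimpleGraph V} (hc : G.Connected) {X : Set V} {u v : V} {S s : ℕ}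
    (h : ReachIn G X u v) (hd : S ≤ G.dist u v) (hS : 2 * s ≤ S) {w : V} (hw : ReachIn G X u w) :
    ∃ w', ReachIn G X w w' ∧ s ≤ G.dist w w' := by
  by_cases h1 : s ≤ G.dist w u
  · exact ⟨u, hw.symm, h1⟩
  · refine ⟨v, hw.symm.trans h, ?_⟩
    have := hc.dist_triangle (u := u) (v := w) (w := v)
    rw [SimpleGraph.dist_comm] at h1
    omega

theorem card_arm {G : SimpleGraph V} (hc : G.Connected) {X B : Set V} {u v : V} {S : ℕ}
    (h : ReachIn G X u v) (hd : S ≤ G.dist u v) (hB : B.Finite)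
    (hX : ∀ y, ReachIn G X u y → y ∈ B) : S ≤ B.ncard := by
  have h1 : (Finset.range S : Set ℕ) ⊆ (fun y => G.dist u y) '' B := by
    intro t ht
    simp only [Finset.coe_range, Set.mem_Iio] at ht
    obtain ⟨v', h3, h4⟩ := trunc hc h (show t ≤ G.dist u v by omega)
    exact ⟨v', hX _ (h3.mono Set.inter_subset_left), h4⟩
  have h2 := Set.ncard_le_ncard h1 (hB.image _)
  rw [Set.ncard_coe_finset, Finset.card_range] at h2
  exact h2.trans (Set.ncard_image_le hB)

theorem geom {G : SimpleGraph V} (hc : G.Connected)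
    (hinf : ∀ (x : V) (n : ℕ), ∃ y, n ≤ G.dist x y)
    (hfin : ∀ (x : V) (n : ℕ), {y | G.dist x y ≤ n}.Finite) {ω : V → Bool} {s S : ℕ}
    (hs : 1 ≤ s) (hS : 2 * s ≤ S) {x : V} (hsep : SepEv G ω x S) {Z : Set V}
    (hZ : ∀ y, G.dist x y ≤ 3 * S → y ∉ Z → ¬ SepEv G ω y s) :
    ∃ A : Set V, A ⊆ {y | G.dist x y ≤ 3 * S} ∧ S ≤ A.ncard ∧
      S ≤ ({y | G.dist x y ≤ 3 * S} \ A).ncard ∧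
      ∀ a b, a ∈ A → G.dist x b ≤ 3 * S → b ∉ A → G.Adj a b → a ∈ Z ∨ b ∈ Z := by
  obtain ⟨C, h1, ⟨u, v, h2, h2d⟩, ⟨u', v', h3, h3d⟩⟩ := hsep
  set D : Set V := {y | G.dist x y ≤ 3 * S} with hD
  set C' : Set V := {y | ReachIn G C u y} with hC'
  set A0 : Set V := {y | ReachIn G (C ∩ D) u y} with hA0
  have hA0C' : A0 ⊆ C' := fun y hy => ReachIn.mono Set.inter_subset_left hy
  have hC'C : C' ⊆ C := fun y hy => ReachIn.right_mem hy
  have harm : ∀ w ∈ C', ∃ w', ReachIn G C' w w' ∧ s ≤ G.dist w w' := by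
    have hlift : ∀ z, ReachIn G C u z → ReachIn G C' u z := by
      rintro z ⟨hu, hz⟩
      induction hz with
      | refl => exact .refl (ReachIn.refl hu)
      | tail hb hbc ih => exact ih.tail hbc.1 (ReachIn.tail ⟨hu, hb⟩ hbc.1 hbc.2)
    intro w hw
    exact arm_of hc (hlift v (h2.mono Set.inter_subset_left)) h2d hS (hlift w hw)
  have hcl : ∀ y ∈ D, ∀ u v, u ∈ C' → v ∉ C' → G.Adj u v → G.dist y v ≤ 6 * s →
      ω v = false := by
    intro y hy a b ha hb hab hyb
    refine h1 a b (hC'C ha) (fun hbC => hb (ReachIn.tail ha hab hbC)) hab ?_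
    have := hc.dist_triangle (u := x) (v := y) (w := b)
    have : G.dist x y ≤ 3 * S := hy
    omega
  set A1 : Set V := {y | ∃ a ∈ A0, ReachIn G (D \ Z) a y} with hA1
  have hhit : ∀ y ∈ A1, ∃ w ∈ C', G.dist y w ≤ s + 1 := by
    rintro y ⟨a, ha, ha', hr⟩
    induction hr with
    | refl => exact ⟨a, hA0C' ha, by simp⟩
    | @tail b c hb hbc ih =>
      have hbm : b ∈ D \ Z := ReachIn.right_mem ⟨ha', hb⟩
      exact chain_step hc hinf hs harm (hcl b hbm.1) ih hbc.1 (hZ b hbm.1 hbm.2)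
  have hA1D : A1 ⊆ D \ Z := by
    rintro y ⟨a, ha, hr⟩; exact hr.right_mem
  have hA0D : A0 ⊆ D := fun y hy => (ReachIn.right_mem hy).2
  have hsub : A0 ∪ A1 ⊆ D := Set.union_subset hA0D (hA1D.trans Set.sdiff_subset)
  refine ⟨A0 ∪ A1, hsub, ?_, ?_, ?_⟩
  · exact card_arm hc h2 h2d ((hfin _ _).subset hsub) (fun y hy => Or.inl hy)
  · refine card_arm hc h3 h3d ((hfin _ _).subset Set.sdiff_subset) (fun y hy => ?_)
    have hym := hy.right_mem
    refine ⟨hym.1, ?_⟩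
    rintro (hy0 | hy1)
    · exact hym.2.1 (hC'C (hA0C' hy0))
    · have hyD := hA1D hy1
      apply hZ y hyD.1 hyD.2
      obtain ⟨t, ht1, ht2⟩ := arm_of hc h3 h3d hS hy
      refine mkSep hc hs harm (hcl y hyD.1) (hhit y hy1) (z := y) (by simp) (ht1.mono ?_) ht2
      rintro a ⟨-, ha1, ha2⟩
      exact ⟨fun h => ha1 (hC'C h), fun c h => ha2 c (hC'C h)⟩
  · intro a b ha hb hbA hab
    by_contra hcon
    push Not at hcon
    have : a ∈ A1 := by
      rcases ha with ha | ha
      · exact ⟨a, ha, ReachIn.refl ⟨hA0D ha, hcon.1⟩⟩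
      · exact ha
    obtain ⟨a', ha', hr⟩ := this
    exact hbA (Or.inr ⟨a', ha', hr.tail hab ⟨hb, hcon.2⟩⟩)

/-- Deterministic: good at all scales implies an infinite set with closed boundary. -/
theorem grow {G : SimpleGraph V} (hc : G.Connected)
    (hinf : ∀ (x : V) (n : ℕ), ∃ y, n ≤ G.dist x y) {ω : V → Bool} {o : V} {C : Set V}
    {s S : ℕ} (hs : 1 ≤ s) (hS : 2 * s ≤ S)
    (hC : ∀ w ∈ C, ReachIn G C o w) (ho : o ∈ C)
    (hcl : ∀ u v, u ∈ C → v ∉ C → G.Adj u v → ω v = false)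
    (hgood : ∀ y, G.dist o y ≤ 3 * S → ¬ SepEv G ω y s)
    (h : ∃ w ∈ C, 2 * s ≤ G.dist o w) : ∃ w ∈ C, 2 * S ≤ G.dist o w := by
  obtain ⟨w, hw, hd⟩ := h
  have harm : ∀ w ∈ C, ∃ w', ReachIn G C w w' ∧ s ≤ G.dist w w' := fun w' hw' =>
    arm_of hc (hC w hw) hd le_rfl (hC w' hw')
  obtain ⟨t, ht⟩ := hinf o (3 * S)
  obtain ⟨t', h1, h2⟩ := trunc hc (reach_univ hc o t) ht
  have key : ∀ z, ReachIn G (Set.univ ∩ {y | G.dist o y ≤ 3 * S}) o z →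
      ∃ w ∈ C, G.dist z w ≤ s + 1 := by
    rintro z ⟨h3, hr⟩
    induction hr with
    | refl => exact ⟨o, ho, by simp⟩
    | @tail b c hb hbc ih =>
      have hbm := ReachIn.right_mem (⟨h3, hb⟩ : ReachIn G _ o b)
      exact chain_step hc hinf hs harm (fun u v hu hv ha _ => hcl u v hu hv ha) ih hbc.1
        (hgood b hbm.2)
  obtain ⟨z, hz, hzd⟩ := key t' h1
  refine ⟨z, hz, ?_⟩
  have := hc.dist_triangle (u := o) (v := z) (w := t')
  rw [SimpleGraph.dist_comm] at hzd
  omega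

theorem inf_cluster {G : SimpleGraph V} (hc : G.Connected)
    (hinf : ∀ (x : V) (n : ℕ), ∃ y, n ≤ G.dist x y)
    (hfin : ∀ (x : V) (n : ℕ), {y | G.dist x y ≤ n}.Finite) {ω : V → Bool} {o : V}
    (σ : ℕ → ℕ) (h0 : 1 ≤ σ 0) (hσ : ∀ k, 2 * σ k ≤ σ (k + 1))
    (hgood : ∀ k y, G.dist o y ≤ 3 * σ (k + 1) → ¬ SepEv G ω y (σ k)) :
    ∃ x, (openCluster G ω x).Infinite := by
  set X : Set V := {y | G.dist o y ≤ 2 * σ 0 ∨ ω y = true} with hX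
  set C : Set V := {y | ReachIn G X o y} with hCdef
  have hoX : o ∈ X := Or.inl (by simp)
  have hC : ∀ w ∈ C, ReachIn G C o w := by
    rintro z ⟨hu, hz⟩
    induction hz with
    | refl => exact .refl (ReachIn.refl hu)
    | tail hb hbc ih => exact ih.tail hbc.1 (ReachIn.tail ⟨hu, hb⟩ hbc.1 hbc.2)
  have hcl : ∀ u v, u ∈ C → v ∉ C → G.Adj u v → ω v = false := by
    intro u v hu hv ha
    by_contra hcon
    exact hv (ReachIn.tail hu ha (Or.inr (by simpa using hcon)))
  have hpos : ∀ k, k + 1 ≤ σ k := by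
    intro k
    induction k with
    | zero => exact h0
    | succ k ih => have := hσ k; omega
  have hk : ∀ k, ∃ w ∈ C, 2 * σ k ≤ G.dist o w := by
    intro k
    induction k with
    | zero =>
      obtain ⟨t, ht⟩ := hinf o (2 * σ 0)
      obtain ⟨t', h1, h2⟩ := trunc hc (reach_univ hc o t) ht
      exact ⟨t', h1.mono (fun y hy => Or.inl hy.2), h2.ge⟩
    | succ k ih =>
      exact grow hc hinf (by have := hpos k; omega) (hσ k) hC (ReachIn.refl hoX) hcl (hgood k) ih
  have hCinf : C.Infinite := by
    intro hCf
    obtain ⟨N, hN⟩ := (hCf.image (fun y => G.dist o y)).bddAbove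
    obtain ⟨w, hw, hd⟩ := hk N
    have := hN ⟨w, hw, rfl⟩
    have := hpos N
    simp only at *
    omega
  by_contra hcon
  push Not at hcon
  apply hCinf
  have hsub : C ⊆ {y | G.dist o y ≤ 2 * σ 0} ∪
      ⋃ v ∈ {y | G.dist o y ≤ 2 * σ 0 + 1}, openCluster G ω v := by
    rintro z ⟨hu, hz⟩
    induction hz with
    | refl => exact Or.inl (by simp)
    | @tail b c hb hbc ih =>
      by_cases hcb : G.dist o c ≤ 2 * σ 0
      · exact Or.inl hcb
      · right
        have hωc : ω c = true := hbc.2.resolve_left hcb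
        rcases ih with ih | ih
        · refine Set.mem_biUnion (x := c) ?_ ?_
          · have := dist_step hc (u := o) hbc.1
            simp only [Set.mem_ofPred_eq] at *
            omega
          · exact ⟨hωc, .nil, by simp [hωc]⟩
        · obtain ⟨v, hv, hv1, p, hp⟩ := Set.mem_iUnion₂.1 ih
          refine Set.mem_biUnion (x := v) hv ⟨hv1, p.concat hbc.1, ?_⟩
          intro w hw
          rw [SimpleGraph.Walk.support_concat] at hw
          simp at hw
          rcases hw with hw | rfl
          · exact hp w hw
          · exact hωc
  refine Set.Finite.subset ((hfin _ _).union ((hfin _ _).biUnion fun v _ => ?_)) hsub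
  exact hcon v

theorem gball_nat {G : SimpleGraph V} (hc : G.Connected) (x : V) (n : ℕ) :
    gball G x (n : ℝ) = {y | G.dist x y ≤ n} := by
  ext y
  constructor
  · rintro ⟨p, hp⟩
    exact (SimpleGraph.dist_le p).trans (by exact_mod_cast hp)
  · intro h
    obtain ⟨p, hp⟩ := hc.exists_walk_length_eq_dist x y
    refine ⟨p, ?_⟩
    rw [hp]
    exact_mod_cast h

theorem iso_two {G : SimpleGraph V} (hc : G.Connected) {di ci : ℝ} (hdi : 1 < di) (hci : 0 < ci)
    (hiso : LocalIso G di ci)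
    (hfin : ∀ (x : V) (n : ℕ), {y | G.dist x y ≤ n}.Finite) (x : V) (n : ℕ) (hn : 1 ≤ n)
    (A : Set V) (hA : A ⊆ {y | G.dist x y ≤ n}) (S : ℕ) (h1 : S ≤ A.ncard)
    (h2 : S ≤ ({y | G.dist x y ≤ n} \ A).ncard) :
    ci * (S : ℝ) ^ ((di - 1) / di) ≤ (relBoundary G A {y | G.dist x y ≤ n}).ncard := by
  have hα : 0 ≤ (di - 1) / di := div_nonneg (by linarith) (by linarith)
  have hI := hiso x n (by exact_mod_cast hn)
  rw [gball_nat hc] at hI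
  set B : Set V := {y | G.dist x y ≤ n} with hBdef
  have hB : B.Finite := hfin x n
  have mono : ∀ t : ℕ, S ≤ t →
      ci * (S : ℝ) ^ ((di - 1) / di) ≤ ci * (t : ℝ) ^ ((di - 1) / di) := by
    intro t ht
    gcongr
  have hsum : (B \ A).ncard + A.ncard = B.ncard := Set.ncard_sdiff_add_ncard_of_subset hA hB
  have hsum' : ((B \ A).ncard : ℝ) + A.ncard = B.ncard := by exact_mod_cast hsum
  by_cases hle : (A.ncard : ℝ) ≤ B.ncard / 2
  · exact (mono _ h1).trans (hI A hA hle)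
  · refine (mono _ h2).trans ((hI (B \ A) Set.sdiff_subset (by linarith)).trans ?_)
    have hf : (relBoundary G A B).Finite := by
      refine (hB.prod hB).subset ?_
      rintro ⟨a, b⟩ ⟨-, ha, hb, -⟩
      exact ⟨hA ha, hb⟩
    have hs : relBoundary G (B \ A) B ⊆ Prod.swap '' relBoundary G A B := by
      rintro ⟨a, b⟩ ⟨h, ha, hb, hb'⟩
      refine ⟨(b, a), ⟨h.symm, ?_, ha.1, ha.2⟩, rfl⟩
      by_contra hbA
      exact hb' ⟨hb, hbA⟩
    exact_mod_cast (Set.ncard_le_ncard hs (hf.image _)).trans (Set.ncard_image_le hf)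

theorem edge_count {G : SimpleGraph V}
    (hfin : ∀ (x : V) (n : ℕ), {y | G.dist x y ≤ n}.Finite) {K : ℕ}
    (hK : ∀ x : V, {y | G.dist x y ≤ 1}.ncard ≤ K) (Z : Finset V) (E : Set (V × V))
    (hE : ∀ e ∈ E, G.Adj e.1 e.2 ∧ (e.1 ∈ Z ∨ e.2 ∈ Z)) : E.ncard ≤ Z.card * (2 * K) := by
  classical
  set N : V → Finset V := fun z => (hfin z 1).toFinset with hN
  have hNc : ∀ z, (N z).card ≤ K := fun z => by
    rw [hN]; simp only; rw [← Set.ncard_eq_toFinset_card _ (hfin _ _)]; exact hK z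
  set F : Finset (V × V) := Z.biUnion (fun z => ({z} ×ˢ N z) ∪ (N z ×ˢ {z})) with hF
  have hsub : E ⊆ (F : Set (V × V)) := by
    rintro ⟨a, b⟩ he
    obtain ⟨h1, h2⟩ := hE _ he
    simp only at h1 h2
    simp only [hF, hN, Finset.coe_biUnion, Set.mem_iUnion, Finset.mem_coe, Finset.mem_union,
      Finset.mem_product, Finset.mem_singleton, Set.Finite.mem_toFinset, Set.mem_ofPred_eq]
    rcases h2 with h2 | h2
    · exact ⟨a, h2, Or.inl ⟨rfl, (SimpleGraph.dist_eq_one_iff_adj.2 h1).le⟩⟩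
    · exact ⟨b, h2, Or.inr ⟨(SimpleGraph.dist_eq_one_iff_adj.2 h1.symm).le, rfl⟩⟩
  calc E.ncard ≤ (F : Set (V × V)).ncard := Set.ncard_le_ncard hsub F.finite_toSet
    _ = F.card := Set.ncard_coe_finset F
    _ ≤ Z.card * (2 * K) := by
      apply Finset.card_biUnion_le_card_mul
      intro z _
      refine (Finset.card_union_le _ _).trans ?_
      simp only [Finset.card_product, Finset.card_singleton]
      have := hNc z
      omega

theorem cover (G : SimpleGraph V) (Bad : Set V) (r J : ℕ) :
    (∃ T : Finset V, (T : Set V) ⊆ Bad ∧ T.card = J ∧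
      ∀ a ∈ T, ∀ b ∈ T, a ≠ b → r < G.dist a b) ∨
    (∃ T : Finset V, T.card ≤ J ∧ ∀ y ∈ Bad, ∃ z ∈ T, G.dist z y ≤ r) := by
  classical
  induction J with
  | zero => exact Or.inl ⟨∅, by simp, rfl, by simp⟩
  | succ J ih =>
    rcases ih with ⟨T, h1, h2, h3⟩ | ⟨T, h1, h2⟩
    · by_cases h : ∀ y ∈ Bad, ∃ z ∈ T, G.dist z y ≤ r
      · exact Or.inr ⟨T, by omega, h⟩
      · push Not at h
        obtain ⟨y, hy, hyT⟩ := h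
        left
        have hynot : y ∉ T := fun h => by have := hyT y h; simp at this
        refine ⟨insert y T, ?_, ?_, ?_⟩
        · rw [Finset.coe_insert]
          exact Set.insert_subset hy h1
        · rw [Finset.card_insert_of_notMem hynot, h2]
        · intro a ha b hb hab
          rw [Finset.mem_insert] at ha hb
          rcases ha with rfl | ha <;> rcases hb with rfl | hb
          · exact absurd rfl hab
          · rw [SimpleGraph.dist_comm]; exact hyT b hb
          · exact hyT a ha
          · exact h3 a ha b hb hab
    · exact Or.inr ⟨T, by omega, h2⟩

theorem many_bad {G : SimpleGraph V} (hc : G.Connected) {di ci : ℝ} (hdi : 1 < di) (hci : 0 < ci)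
    (hiso : LocalIso G di ci)
    (hinf : ∀ (x : V) (n : ℕ), ∃ y, n ≤ G.dist x y)
    (hfin : ∀ (x : V) (n : ℕ), {y | G.dist x y ≤ n}.Finite) {K D : ℕ}
    (hvol : ∀ (x : V) (n : ℕ), 1 ≤ n → {y | G.dist x y ≤ n}.ncard ≤ K * n ^ D)
    {s S J : ℕ} (hs : 1 ≤ s) (hS : 2 * s ≤ S)
    (hbig : ((J * (K * (12 * s) ^ D) * (2 * K) : ℕ) : ℝ) < ci * (S : ℝ) ^ ((di - 1) / di))
    {ω : V → Bool} {x : V} (hsep : SepEv G ω x S) :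
    ∃ T : Finset V, (∀ y ∈ T, G.dist x y ≤ 3 * S ∧ SepEv G ω y s) ∧ T.card = J ∧
      ∀ a ∈ T, ∀ b ∈ T, a ≠ b → 12 * s < G.dist a b := by
  classical
  rcases cover G {y | G.dist x y ≤ 3 * S ∧ SepEv G ω y s} (12 * s) J with
    ⟨T, h1, h2, h3⟩ | ⟨T, h1, h2⟩
  · exact ⟨T, fun y hy => h1 hy, h2, h3⟩
  · exfalso
    set Z : Finset V := T.biUnion (fun z => (hfin z (12 * s)).toFinset) with hZ
    have hZc : Z.card ≤ J * (K * (12 * s) ^ D) := by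
      refine (Finset.card_biUnion_le_card_mul _ _ (K * (12 * s) ^ D) ?_).trans
        (Nat.mul_le_mul_right _ h1)
      intro z _
      rw [← Set.ncard_eq_toFinset_card _ (hfin _ _)]
      exact hvol z _ (by omega)
    obtain ⟨A, hA, hA1, hA2, hA3⟩ := geom hc hinf hfin hs hS hsep (Z := (Z : Set V)) (by
      intro y hy hyZ hsy
      obtain ⟨z, hz, hzd⟩ := h2 y ⟨hy, hsy⟩
      apply hyZ
      simp only [hZ, Finset.coe_biUnion, Set.mem_iUnion, Finset.mem_coe,
        Set.Finite.mem_toFinset, Set.mem_ofPred_eq]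
      exact ⟨z, hz, hzd⟩)
    have h4 := iso_two hc hdi hci hiso hfin x (3 * S) (by omega) A hA S hA1 hA2
    have h5 := edge_count hfin (K := K) (fun x => by simpa using hvol x 1 le_rfl) Z
      (relBoundary G A {y | G.dist x y ≤ 3 * S}) (by
        rintro ⟨a, b⟩ ⟨e1, e2, e3, e4⟩
        exact ⟨e1, hA3 a b e2 e3 e4 e1⟩)
    have h6 := h5.trans (Nat.mul_le_mul_right (2 * K) hZc)
    have h7 : ((relBoundary G A {y | G.dist x y ≤ 3 * S}).ncard : ℝ) ≤
      ((J * (K * (12 * s) ^ D) * (2 * K) : ℕ) : ℝ) := by exact_mod_cast h6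
    linarith

/-- The event `E` only depends on the coordinates in `S`. -/
def DepOn (E : Set (V → Bool)) (S : Finset V) : Prop :=
  ∀ ω ω' : V → Bool, (∀ v ∈ S, ω v = ω' v) → ω ∈ E → ω' ∈ E

theorem DepOn.eq {E : Set (V → Bool)} {S : Finset V} (h : DepOn E S) :
    E = (fun (ω : V → Bool) (i : S) => ω i) ⁻¹' ((fun (ω : V → Bool) (i : S) => ω i) '' E) := by
  apply Set.Subset.antisymm (Set.subset_preimage_image _ _)
  rintro ω ⟨ω', h1, h2⟩
  exact h ω' ω (fun v hv => congrFun h2 ⟨v, hv⟩) h1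

theorem indep2 {P : Measure (V → Bool)}
    (hind : ProbabilityTheory.iIndepFun (fun (v : V) (ω : V → Bool) => ω v) P)
    {E F : Set (V → Bool)} {S T : Finset V} (hE : DepOn E S) (hF : DepOn F T)
    (hST : Disjoint S T) : P.real (E ∩ F) = P.real E * P.real F := by
  have h1 := hind.indepFun_finset S T hST (fun i => measurable_pi_apply i)
  have h2 := h1.measure_inter_preimage_eq_mul
    ((fun (ω : V → Bool) (i : S) => ω i) '' E) ((fun (ω : V → Bool) (i : T) => ω i) '' F)
    (Set.toFinite _).measurableSet (Set.toFinite _).measurableSet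
  rw [← hE.eq, ← hF.eq] at h2
  simp [Measure.real, h2]

theorem prob_inter {G : SimpleGraph V} (hc : G.Connected)
    (hfin : ∀ (x : V) (n : ℕ), {y | G.dist x y ≤ n}.Finite) {P : Measure (V → Bool)}
    [IsProbabilityMeasure P]
    (hind : ProbabilityTheory.iIndepFun (fun (v : V) (ω : V → Bool) => ω v) P) {s : ℕ} {q : ℝ}
    (hq : ∀ x, P.real {ω | SepEv G ω x s} ≤ q) (T : Finset V)
    (hT : ∀ a ∈ T, ∀ b ∈ T, a ≠ b → 12 * s < G.dist a b) :
    P.real {ω | ∀ y ∈ T, SepEv G ω y s} ≤ q ^ T.card := by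
  classical
  induction T using Finset.induction_on with
  | empty => simp
  | @insert a T ha ih =>
    have ih' := ih (fun a ha b hb => hT a (Finset.mem_insert_of_mem ha) b
      (Finset.mem_insert_of_mem hb))
    have heq : {ω : V → Bool | ∀ y ∈ insert a T, SepEv G ω y s} =
        {ω | SepEv G ω a s} ∩ {ω | ∀ y ∈ T, SepEv G ω y s} := by
      ext ω; simp
    have hE : DepOn {ω : V → Bool | SepEv G ω a s} (hfin a (6 * s)).toFinset := by
      intro ω ω' h hω
      exact SepEv.congr (fun v hv => h v (by simpa using hv)) hω
    have hF : DepOn {ω : V → Bool | ∀ y ∈ T, SepEv G ω y s}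
        (T.biUnion fun z => (hfin z (6 * s)).toFinset) := by
      intro ω ω' h hω y hy
      refine SepEv.congr (fun v hv => h v ?_) (hω y hy)
      rw [Finset.mem_biUnion]
      exact ⟨y, hy, by simpa using hv⟩
    have hdis : Disjoint (hfin a (6 * s)).toFinset
        (T.biUnion fun z => (hfin z (6 * s)).toFinset) := by
      rw [Finset.disjoint_left]
      intro v hv hv'
      obtain ⟨z, hz, hvz⟩ := Finset.mem_biUnion.1 hv'
      have h1 : G.dist a v ≤ 6 * s := by simpa using hv
      have h2 : G.dist z v ≤ 6 * s := by simpa using hvz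
      have h3 := hT a (Finset.mem_insert_self _ _) z (Finset.mem_insert_of_mem hz)
        (fun h => ha (h ▸ hz))
      have h4 := hc.dist_triangle (u := a) (v := v) (w := z)
      rw [SimpleGraph.dist_comm] at h2
      omega
    rw [heq, indep2 hind hE hF hdis, Finset.card_insert_of_notMem ha, pow_succ']
    have h0 : (0 : ℝ) ≤ P.real {ω | SepEv G ω a s} := measureReal_nonneg
    exact mul_le_mul (hq a) ih' measureReal_nonneg (h0.trans (hq a))

theorem choose_le_pow' (n k : ℕ) : n.choose k ≤ n ^ k := by
  exact Nat.choose_le_pow n k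

theorem prob_step {G : SimpleGraph V} (hc : G.Connected) {di ci : ℝ} (hdi : 1 < di) (hci : 0 < ci)
    (hiso : LocalIso G di ci)
    (hinf : ∀ (x : V) (n : ℕ), ∃ y, n ≤ G.dist x y)
    (hfin : ∀ (x : V) (n : ℕ), {y | G.dist x y ≤ n}.Finite) {K D : ℕ}
    (hvol : ∀ (x : V) (n : ℕ), 1 ≤ n → {y | G.dist x y ≤ n}.ncard ≤ K * n ^ D)
    {s S J : ℕ} (hs : 1 ≤ s) (hS : 2 * s ≤ S)
    (hbig : ((J * (K * (12 * s) ^ D) * (2 * K) : ℕ) : ℝ) < ci * (S : ℝ) ^ ((di - 1) / di))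
    {P : Measure (V → Bool)} [IsProbabilityMeasure P]
    (hind : ProbabilityTheory.iIndepFun (fun (v : V) (ω : V → Bool) => ω v) P) {q : ℝ}
    (hq : ∀ x, P.real {ω | SepEv G ω x s} ≤ q) (x : V) :
    P.real {ω | SepEv G ω x S} ≤ ((K * (3 * S) ^ D : ℕ) * q) ^ J := by
  classical
  have hq0 : 0 ≤ q := measureReal_nonneg.trans (hq x)
  set B : Finset V := (hfin x (3 * S)).toFinset with hB
  have hBc : B.card ≤ K * (3 * S) ^ D := by
    rw [hB, ← Set.ncard_eq_toFinset_card _ (hfin _ _)]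
    exact hvol x _ (by omega)
  set 𝓣 : Finset (Finset V) := (B.powersetCard J).filter
    (fun T => ∀ a ∈ T, ∀ b ∈ T, a ≠ b → 12 * s < G.dist a b) with h𝓣
  have hsub : {ω | SepEv G ω x S} ⊆ ⋃ T ∈ 𝓣, {ω | ∀ y ∈ T, SepEv G ω y s} := by
    intro ω hω
    obtain ⟨T, h1, h2, h3⟩ := many_bad hc hdi hci hiso hinf hfin hvol hs hS hbig hω
    refine Set.mem_biUnion (x := T) ?_ (fun y hy => (h1 y hy).2)
    rw [h𝓣, Finset.mem_coe, Finset.mem_filter, Finset.mem_powersetCard]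
    exact ⟨⟨fun y hy => by simpa [hB] using (h1 y hy).1, h2⟩, h3⟩
  calc P.real {ω | SepEv G ω x S}
      ≤ P.real (⋃ T ∈ 𝓣, {ω | ∀ y ∈ T, SepEv G ω y s}) := measureReal_mono hsub (measure_ne_top P _)
    _ ≤ ∑ T ∈ 𝓣, P.real {ω | ∀ y ∈ T, SepEv G ω y s} := measureReal_biUnion_finset_le _ _
    _ ≤ ∑ T ∈ 𝓣, q ^ J := by
      apply Finset.sum_le_sum
      intro T hT
      rw [h𝓣, Finset.mem_filter, Finset.mem_powersetCard] at hT
      have := prob_inter hc hfin hind hq T hT.2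
      rwa [hT.1.2] at this
    _ = 𝓣.card * q ^ J := by simp
    _ ≤ ((K * (3 * S) ^ D : ℕ) : ℝ) ^ J * q ^ J := by
      gcongr
      have h1 : 𝓣.card ≤ (K * (3 * S) ^ D) ^ J := by
        refine (Finset.card_filter_le _ _).trans ?_
        rw [Finset.card_powersetCard]
        exact (choose_le_pow' _ _).trans (Nat.pow_le_pow_left hBc _)
      exact_mod_cast h1
    _ = _ := (mul_pow _ _ _).symm

theorem prob_base {G : SimpleGraph V} (hc : G.Connected)
    (hfin : ∀ (x : V) (n : ℕ), {y | G.dist x y ≤ n}.Finite) {K D : ℕ}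
    (hvol : ∀ (x : V) (n : ℕ), 1 ≤ n → {y | G.dist x y ≤ n}.ncard ≤ K * n ^ D)
    {s : ℕ} (hs : 1 ≤ s) {P : Measure (V → Bool)} [IsProbabilityMeasure P] {ε : ℝ}
    (hε : ∀ v, P.real {ω | ω v = false} ≤ ε) (x : V) :
    P.real {ω | SepEv G ω x s} ≤ (K * (6 * s) ^ D : ℕ) * ε := by
  have hε0 : 0 ≤ ε := measureReal_nonneg.trans (hε x)
  set B : Finset V := (hfin x (6 * s)).toFinset with hB
  have hBc : B.card ≤ K * (6 * s) ^ D := by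
    rw [hB, ← Set.ncard_eq_toFinset_card _ (hfin _ _)]
    exact hvol x _ (by omega)
  have hsub : {ω | SepEv G ω x s} ⊆ ⋃ v ∈ B, {ω | ω v = false} := by
    intro ω hω
    obtain ⟨v, h1, h2⟩ := SepEv.exists_closed hc hω
    exact Set.mem_biUnion (x := v) (by simpa [hB] using h1) h2
  calc P.real {ω | SepEv G ω x s}
      ≤ P.real (⋃ v ∈ B, {ω : V → Bool | ω v = false}) := measureReal_mono hsub (measure_ne_top P _)
    _ ≤ ∑ v ∈ B, P.real {ω : V → Bool | ω v = false} := measureReal_biUnion_finset_le _ _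
    _ ≤ ∑ v ∈ B, ε := Finset.sum_le_sum fun v _ => hε v
    _ = B.card * ε := by simp
    _ ≤ _ := by
      gcongr

theorem exists_bernoulli (V : Type u) (p : ℝ) (hp0 : 0 ≤ p) (hp1 : p ≤ 1) :
    ∃ P : Measure (V → Bool), IsProbabilityMeasure P ∧ IsBernoulli P p ∧
      ProbabilityTheory.iIndepFun (fun (v : V) (ω : V → Bool) => ω v) P ∧
      ∀ v, P.real {ω | ω v = false} ≤ 1 - p := by
  classical
  set μ : Measure Bool := ENNReal.ofReal p • Measure.dirac true +
    ENNReal.ofReal (1 - p) • Measure.dirac false with hμ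
  have ht : μ {true} = ENNReal.ofReal p := by simp [hμ]
  have hf : μ {false} = ENNReal.ofReal (1 - p) := by simp [hμ]
  have : IsProbabilityMeasure μ := by
    constructor
    simp only [hμ, Measure.coe_add, Measure.coe_smul, Pi.add_apply, Pi.smul_apply, measure_univ,
      smul_eq_mul, mul_one]
    rw [← ENNReal.ofReal_add hp0 (by linarith)]
    simp
  have hB : IsBernoulli (Measure.infinitePi (fun _ : V => μ)) p := by
    intro F η
    have h1 : {ω : V → Bool | ∀ x ∈ F, ω x = η x} = Set.pi F (fun x => {η x}) := by
      ext ω; simp [Set.mem_pi]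
    rw [h1, Measure.infinitePi_pi _ (fun _ _ => measurableSet_singleton _)]
    have h2 : ∀ x, μ {η x} = ENNReal.ofReal (if η x = true then p else 1 - p) := by
      intro x
      cases h : η x <;> simp [ht, hf]
    simp_rw [h2]
    rw [← ENNReal.ofReal_prod_of_nonneg (fun i _ => by split_ifs <;> linarith),
      Finset.prod_ite]
    simp
  refine ⟨Measure.infinitePi (fun _ : V => μ), inferInstance, hB, ?_, ?_⟩
  · exact ProbabilityTheory.iIndepFun_infinitePi (X := fun _ b => b) (fun _ => measurable_id)
  · intro v
    have := hB {v} (fun _ => false)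
    simp at this
    rw [Measure.real, this, ENNReal.toReal_ofReal (by linarith)]

theorem arith1 {K D m s : ℕ} (hs : K * 3 ^ D ≤ s) (hs1 : 1 ≤ s) :
    ((K * (3 * s ^ m) ^ D : ℕ) : ℝ) * (1 / (s : ℝ) ^ (2 * m * D + 2)) ≤
      1 / (s : ℝ) ^ (m * D + 1) := by
  have h1 : K * (3 * s ^ m) ^ D ≤ s ^ (m * D + 1) := by
    calc K * (3 * s ^ m) ^ D = (K * 3 ^ D) * s ^ (m * D) := by rw [mul_pow, ← pow_mul]; ring
      _ ≤ s * s ^ (m * D) := Nat.mul_le_mul_right _ hs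
      _ = s ^ (m * D + 1) := by ring
  have hpos : (0 : ℝ) < s := by exact_mod_cast hs1
  have h2 : ((K * (3 * s ^ m) ^ D : ℕ) : ℝ) ≤ (s : ℝ) ^ (m * D + 1) := by exact_mod_cast h1
  calc _ ≤ (s : ℝ) ^ (m * D + 1) * (1 / (s : ℝ) ^ (2 * m * D + 2)) := by gcongr
    _ = _ := by
      rw [show 2 * m * D + 2 = (m * D + 1) + (m * D + 1) by ring, pow_add]
      field_simp
      ring

theorem arith2 {K D m s : ℕ} (hs : K * 3 ^ D ≤ s) (hs1 : 1 ≤ s) :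
    (((K * (3 * s ^ m) ^ D : ℕ) : ℝ) * (1 / (s : ℝ) ^ (2 * m * D + 2))) ^ (2 * m) ≤
      1 / ((s ^ m : ℕ) : ℝ) ^ (2 * m * D + 2) := by
  calc _ ≤ (1 / (s : ℝ) ^ (m * D + 1)) ^ (2 * m) := by
        gcongr
        exact arith1 hs hs1
    _ = _ := by
      rw [div_pow, one_pow, ← pow_mul]
      push_cast
      rw [← pow_mul]
      congr 2
      ring

theorem arith3 {K D m J s : ℕ} {α ci : ℝ} (hci : 0 < ci) (hα : (D : ℝ) + 1 ≤ m * α) (hs1 : 1 ≤ s)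
    (hs : ((J * K * 12 ^ D * (2 * K) : ℕ) : ℝ) < ci * s) :
    ((J * (K * (12 * s) ^ D) * (2 * K) : ℕ) : ℝ) < ci * ((s ^ m : ℕ) : ℝ) ^ α := by
  have hs0 : (1 : ℝ) ≤ s := by exact_mod_cast hs1
  have h1 : (s : ℝ) ^ (D + 1) ≤ ((s ^ m : ℕ) : ℝ) ^ α := by
    push_cast
    rw [← Real.rpow_natCast (s : ℝ) m, ← Real.rpow_mul (by linarith), ← Real.rpow_natCast]
    apply Real.rpow_le_rpow_of_exponent_le hs0
    push_cast
    exact hα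
  calc ((J * (K * (12 * s) ^ D) * (2 * K) : ℕ) : ℝ)
      = ((J * K * 12 ^ D * (2 * K) : ℕ) : ℝ) * (s : ℝ) ^ D := by push_cast; ring
    _ < ci * s * (s : ℝ) ^ D := by gcongr
    _ = ci * (s : ℝ) ^ (D + 1) := by ring
    _ ≤ _ := by gcongr

theorem main_pos {G : SimpleGraph V} (hc : G.Connected) {di ci : ℝ} (hdi : 1 < di) (hci : 0 < ci)
    (hiso : LocalIso G di ci)
    (hinf : ∀ (x : V) (n : ℕ), ∃ y, n ≤ G.dist x y)
    (hfin : ∀ (x : V) (n : ℕ), {y | G.dist x y ≤ n}.Finite) {K D m s₀ : ℕ}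
    (hvol : ∀ (x : V) (n : ℕ), 1 ≤ n → {y | G.dist x y ≤ n}.ncard ≤ K * n ^ D)
    (hm : 2 ≤ m) (hα : (D : ℝ) + 1 ≤ m * ((di - 1) / di)) (hs4 : 4 ≤ s₀)
    (hsK : K * 3 ^ D ≤ s₀) (hsc : ((2 * m * K * 12 ^ D * (2 * K) : ℕ) : ℝ) < ci * s₀)
    {P : Measure (V → Bool)} [IsProbabilityMeasure P]
    (hind : ProbabilityTheory.iIndepFun (fun (v : V) (ω : V → Bool) => ω v) P)
    {ε : ℝ} (hε : ∀ v, P.real {ω | ω v = false} ≤ ε)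
    (hεs : (K * (6 * s₀) ^ D : ℕ) * ε ≤ 1 / (s₀ : ℝ) ^ (2 * m * D + 2)) (o : V) :
    P {ω | ∃ x : V, (openCluster G ω x).Infinite} ≠ 0 := by
  classical
  set σ : ℕ → ℕ := fun k => s₀ ^ (m ^ k) with hσ
  have hσ0 : σ 0 = s₀ := by simp [hσ]
  have hσs : ∀ k, σ (k + 1) = σ k ^ m := fun k => by
    simp only [hσ]; rw [pow_succ, pow_mul]
  have hσge : ∀ k, s₀ ≤ σ k := fun k => Nat.le_self_pow (by positivity) _
  have hσ2 : ∀ k, 2 * σ k ≤ σ (k + 1) := fun k => by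
    rw [hσs]
    calc 2 * σ k ≤ σ k * σ k := Nat.mul_le_mul_right _ (by have := hσge k; omega)
      _ = σ k ^ 2 := by ring
      _ ≤ σ k ^ m := Nat.pow_le_pow_right (by have := hσge k; omega) hm
  have hσpow : ∀ k, 2 ^ (k + 2) ≤ σ k := by
    intro k
    induction k with
    | zero => rw [hσ0]; simpa using hs4
    | succ k ih => have := hσ2 k; rw [pow_succ]; omega
  have hprob : ∀ k x, P.real {ω | SepEv G ω x (σ k)} ≤ 1 / (σ k : ℝ) ^ (2 * m * D + 2) := by
    intro k
    induction k with
    | zero =>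
      intro x
      rw [hσ0]
      exact (prob_base hc hfin hvol (by omega) hε x).trans hεs
    | succ k ih =>
      intro x
      have hk := hσge k
      have h1 : 1 ≤ σ k := by omega
      have hbig := arith3 (J := 2 * m) (K := K) (m := m) hci hα h1 (lt_of_lt_of_le hsc (by
        gcongr))
      rw [← hσs] at hbig
      have h2 := prob_step hc hdi hci hiso hinf hfin hvol h1 (hσ2 k) hbig hind ih x
      refine h2.trans ?_
      rw [hσs]
      exact arith2 (hsK.trans hk) h1
  set bad : ℕ → Set (V → Bool) := fun k =>
    ⋃ y ∈ (hfin o (3 * σ (k + 1))).toFinset, {ω | SepEv G ω y (σ k)} with hbad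
  have hbadk : ∀ k, P.real (bad k) ≤ 1 / 4 * (1 / 2 : ℝ) ^ k := by
    intro k
    have hk := hσge k
    have h1 : 1 ≤ σ k := by omega
    have hBc : (hfin o (3 * σ (k + 1))).toFinset.card ≤ K * (3 * σ (k + 1)) ^ D := by
      rw [← Set.ncard_eq_toFinset_card _ (hfin _ _)]
      exact hvol o _ (by have := hσ2 k; omega)
    have hpow : (2 : ℝ) ^ (k + 2) ≤ σ k := by exact_mod_cast hσpow k
    have h1' : (1 : ℝ) ≤ σ k := by exact_mod_cast h1
    calc P.real (bad k)
        ≤ ∑ y ∈ (hfin o (3 * σ (k + 1))).toFinset, P.real {ω | SepEv G ω y (σ k)} :=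
          measureReal_biUnion_finset_le _ _
      _ ≤ ∑ y ∈ (hfin o (3 * σ (k + 1))).toFinset, 1 / (σ k : ℝ) ^ (2 * m * D + 2) :=
          Finset.sum_le_sum fun y _ => hprob k y
      _ = (hfin o (3 * σ (k + 1))).toFinset.card * (1 / (σ k : ℝ) ^ (2 * m * D + 2)) := by
          rw [Finset.sum_const, nsmul_eq_mul]
      _ ≤ ((K * (3 * σ (k + 1)) ^ D : ℕ) : ℝ) * (1 / (σ k : ℝ) ^ (2 * m * D + 2)) := by
          have : ((hfin o (3 * σ (k + 1))).toFinset.card : ℝ) ≤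
            ((K * (3 * σ (k + 1)) ^ D : ℕ) : ℝ) := by exact_mod_cast hBc
          exact mul_le_mul_of_nonneg_right this (by positivity)
      _ ≤ 1 / (σ k : ℝ) ^ (m * D + 1) := by
          rw [hσs]; exact arith1 (hsK.trans hk) h1
      _ ≤ 1 / (σ k : ℝ) := by
          apply one_div_le_one_div_of_le (by linarith)
          exact le_self_pow₀ h1' (by omega)
      _ ≤ 1 / (2 : ℝ) ^ (k + 2) := one_div_le_one_div_of_le (by positivity) hpow
      _ = _ := by rw [pow_add, one_div_pow]; field_simp; norm_num
  have hsum : P (⋃ k, bad k) ≤ ENNReal.ofReal (1 / 2) := by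
    have hs := (hasSum_geometric_two.mul_left (1 / 4 : ℝ))
    calc P (⋃ k, bad k) ≤ ∑' k, P (bad k) := measure_iUnion_le _
      _ ≤ ∑' k, ENNReal.ofReal (1 / 4 * (1 / 2 : ℝ) ^ k) := by
          apply ENNReal.tsum_le_tsum
          intro k
          rw [← ofReal_measureReal (measure_ne_top P _)]
          exact ENNReal.ofReal_le_ofReal (hbadk k)
      _ = ENNReal.ofReal (1 / 2) := by
          rw [← ENNReal.ofReal_tsum_of_nonneg (fun k => by positivity) hs.summable, hs.tsum_eq]
          norm_num
  intro h0
  have hcov : (Set.univ : Set (V → Bool)) ⊆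
      {ω | ∃ x : V, (openCluster G ω x).Infinite} ∪ ⋃ k, bad k := by
    intro ω _
    by_cases hω : ω ∈ ⋃ k, bad k
    · exact Or.inr hω
    · left
      refine inf_cluster hc hinf hfin (o := o) σ (by rw [hσ0]; omega) hσ2 ?_
      intro k y hy hsy
      exact hω (Set.mem_iUnion.2 ⟨k, Set.mem_biUnion (x := y) (by simpa using hy) hsy⟩)
  have h1 := (measure_mono hcov).trans (measure_union_le (μ := P) _ _)
  rw [h0, zero_add, measure_univ] at h1
  have h2 := h1.trans hsum
  rw [← ENNReal.ofReal_one, ENNReal.ofReal_le_ofReal_iff (by norm_num)] at h2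
  norm_num at h2

/-- an infinite, connected, locally finite graph satisfying `L(dᵢ,cᵢ)` and
`𝒱ᵤ(dᵤ,cᵤ)` has `p_c < 1` for site percolation. -/
theorem statement1 {V : Type u} (G : SimpleGraph V) [Infinite V] (hconn : G.Connected)
    (hlf : ∀ v : V, (G.neighborSet v).Finite)
    (di ci du cu : ℝ) (hdi : 1 < di) (hci : 0 < ci) (hdu : 1 < du) (hcu : 0 < cu)
    (hiso : LocalIso G di ci) (hvol : VolUpper G du cu) :
    sSup {p : ℝ | p ∈ Set.Icc (0 : ℝ) 1 ∧
      ∀ P : Measure (V → Bool), IsProbabilityMeasure P → IsBernoulli P p →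
        P {ω | ∃ x : V, (openCluster G ω x).Infinite} = 0} < 1 := by
  classical
  have hvolN : ∀ (x : V) (n : ℕ), 1 ≤ n → {y | G.dist x y ≤ n}.Finite ∧
      {y | G.dist x y ≤ n}.ncard ≤ ⌈cu⌉₊ * n ^ ⌈du⌉₊ := by
    intro x n hn
    have hn' : (1 : ℝ) ≤ n := by exact_mod_cast hn
    obtain ⟨h1, h2⟩ := hvol x n hn'
    rw [gball_nat hconn] at h1 h2
    refine ⟨h1, ?_⟩
    have h3 : cu * (n : ℝ) ^ du ≤ (⌈cu⌉₊ : ℝ) * (n : ℝ) ^ ⌈du⌉₊ := by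
      rw [← Real.rpow_natCast (n : ℝ)]
      gcongr
      · exact Nat.le_ceil _
      · exact Nat.le_ceil _
    exact_mod_cast h2.trans h3
  have hfin : ∀ (x : V) (n : ℕ), {y | G.dist x y ≤ n}.Finite := fun x n =>
    (hvolN x (n + 1) (by omega)).1.subset fun y hy => Nat.le_succ_of_le hy
  have hinf : ∀ (x : V) (n : ℕ), ∃ y, n ≤ G.dist x y := by
    intro x n
    by_contra hcon
    push Not at hcon
    exact Set.infinite_univ ((hfin x n).subset fun y _ => (hcon y).le)
  set K : ℕ := ⌈cu⌉₊ with hK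
  set D : ℕ := ⌈du⌉₊ with hD
  have hK1 : 1 ≤ K := Nat.ceil_pos.2 hcu
  have hα : 0 < (di - 1) / di := div_pos (by linarith) (by linarith)
  obtain ⟨m, hm1⟩ := exists_nat_ge (max 2 (((D : ℝ) + 1) / ((di - 1) / di)))
  have hm : 2 ≤ m := by exact_mod_cast (le_max_left _ _).trans hm1
  have hmα : (D : ℝ) + 1 ≤ m * ((di - 1) / di) :=
    (div_le_iff₀ hα).1 ((le_max_right _ _).trans hm1)
  obtain ⟨t, ht⟩ := exists_nat_gt (((2 * m * K * 12 ^ D * (2 * K) : ℕ) : ℝ) / ci)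
  set s₀ : ℕ := t + 4 + K * 3 ^ D with hs₀
  have hsc : ((2 * m * K * 12 ^ D * (2 * K) : ℕ) : ℝ) < ci * s₀ := by
    rw [div_lt_iff₀ hci] at ht
    refine ht.trans_le ?_
    rw [mul_comm]
    gcongr
    omega
  have hs4 : 4 ≤ s₀ := by omega
  have hsK : K * 3 ^ D ≤ s₀ := by omega
  set M : ℕ := K * (6 * s₀) ^ D * s₀ ^ (2 * m * D + 2) with hM
  have hM1 : 1 ≤ M := by
    have : 0 < s₀ := by omega
    have : 0 < M := by positivity
    omega
  have hM1' : (1 : ℝ) ≤ M := by exact_mod_cast hM1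
  have hMle : 1 / (M : ℝ) ≤ 1 := by
    rw [div_le_one (by linarith)]; exact hM1'
  have hMpos : 0 < 1 / (M : ℝ) := by positivity
  refine lt_of_le_of_lt (Real.sSup_le (a := 1 - 1 / (M : ℝ)) ?_ (by linarith)) (by linarith)
  rintro p ⟨⟨hp0, hp1⟩, hp⟩
  by_contra hlt
  push Not at hlt
  obtain ⟨P, hP1, hP2, hP3, hP4⟩ := exists_bernoulli V p hp0 hp1
  obtain ⟨o⟩ : Nonempty V := inferInstance
  refine main_pos hconn hdi hci hiso hinf hfin (fun x n hn => (hvolN x n hn).2) hm hmα hs4 hsK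
    hsc hP3 (ε := 1 / (M : ℝ)) (fun v => (hP4 v).trans (by linarith)) ?_ o (hp P hP1 hP2)
  have hs0 : (0 : ℝ) < s₀ := by exact_mod_cast (show 0 < s₀ by omega)
  have hKp : (0 : ℝ) < K := by exact_mod_cast hK1
  rw [hM]
  push_cast
  apply le_of_eq
  field_simp
end
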